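/- arXiv:1009.1926 — 6 statements merged into one kernel-verified Lean document; each statement's English description precedes it below -/
import Mathlib

section
/- (Lemma 1, robustness of the marginal.) Under the regression setup with design matrix X (n×q) and response y, let f : (0,∞) → [0,∞) be measurable with ∫_{ℝⁿ} f(‖x‖²) dx = 1, let 0 < ν < q, and assume E_f = ∫_{ℝⁿ} ‖x‖^ν f(‖x‖²) dx < ∞. Then the marginal density of y under the sub-harmonic prior satisfies M_f(y|ν) = (E_f / E_G) · M_{f_G}(y|ν), where E_G = ∫_{ℝⁿ} ‖x‖^ν f_G(‖x‖²) dx is the corresponding moment for the standard Gaussian density f_G(t) = (2π)^{−n/2} e^{−t/2}. In particular, M_f(y|ν) depends on the spherically symmetric error density f only through the scalar E_f. -/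
open MeasureTheory Matrix ENNReal

/-- The marginal density of `y` under model with design `X` and the sub-harmonic prior,
for spherically symmetric error density `x ↦ f(‖x‖²)`. -/
noncomputable def subharmonicMarginal (n : ℕ) {ι : Type} [Fintype ι] [DecidableEq ι]
    (X : Matrix (Fin n) ι ℝ) (y : Fin n → ℝ) (ν : ℝ) (f : ℝ → ℝ) : ℝ≥0∞ :=
  ∫⁻ α : ℝ, ∫⁻ β : ι → ℝ, ∫⁻ η in Set.Ioi (0:ℝ),
    ENNReal.ofReal (η ^ ((n : ℝ) / 2) * f (η * ∑ i, (y i - α - X.mulVec β i) ^ 2)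
      * (Real.Gamma (((Fintype.card ι : ℝ) - ν) / 2)
          / (2 ^ (ν / 2) * Real.pi ^ ((Fintype.card ι : ℝ) / 2)))
      * (Xᵀ * X).det ^ ((1:ℝ) / 2)
      * (β ⬝ᵥ (Xᵀ * X).mulVec β) ^ (-((Fintype.card ι : ℝ) - ν) / 2)
      * η ^ (ν / 2 - 1))

/-- The `ν`-th absolute moment `E_f = ∫_{ℝⁿ} ‖x‖^ν f(‖x‖²) dx`. -/
noncomputable def nuMoment (n : ℕ) (ν : ℝ) (f : ℝ → ℝ) : ℝ≥0∞ :=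
  ∫⁻ x : EuclideanSpace ℝ (Fin n), ENNReal.ofReal (‖x‖ ^ ν * f (‖x‖ ^ 2))

/-- The standard Gaussian kernel `f_G(t) = (2π)^{-n/2} e^{-t/2}`. -/
noncomputable def gaussDensity (n : ℕ) (t : ℝ) : ℝ :=
  (2 * Real.pi) ^ (-(n : ℝ) / 2) * Real.exp (-t / 2)

/-- Polar coordinates for the Lebesgue integral of a radial function. -/
theorem lintegral_fun_norm_addHaar {E : Type*} [NormedAddCommGroup E] [NormedSpace ℝ E]
    [Nontrivial E] [FiniteDimensional ℝ E] [MeasurableSpace E] [BorelSpace E]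
    (μ : Measure E) [μ.IsAddHaarMeasure] {g : ℝ → ℝ≥0∞} (hg : Measurable g) :
    ∫⁻ x, g ‖x‖ ∂μ = μ.toSphere Set.univ *
      ∫⁻ r in Set.Ioi (0 : ℝ), ENNReal.ofReal (r ^ (Module.finrank ℝ E - 1)) * g r := by
  calc ∫⁻ x, g ‖x‖ ∂μ
      = ∫⁻ x : ({(0)}ᶜ : Set E), g ‖x.1‖ ∂(μ.comap (↑)) := by
        rw [lintegral_subtype_comap (measurableSet_singleton _).compl fun x ↦ g ‖x‖,
          restrict_compl_singleton]
    _ = ∫⁻ z, g z.2 ∂μ.toSphere.prod (.volumeIoiPow (Module.finrank ℝ E - 1)) := by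
        rw [← μ.measurePreserving_homeomorphUnitSphereProd.lintegral_comp_emb
          (Homeomorph.measurableEmbedding _)]
        simp
    _ = μ.toSphere Set.univ *
          ∫⁻ r : Set.Ioi (0 : ℝ), g r ∂.volumeIoiPow (Module.finrank ℝ E - 1) := by
        rw [lintegral_prod _ (by fun_prop)]
        simp [mul_comm]
    _ = _ := by
        rw [Measure.volumeIoiPow, lintegral_withDensity_eq_lintegral_mul _ (by fun_prop)
          (by fun_prop)]
        congr 1
        exact lintegral_subtype_comap measurableSet_Ioi
          fun r : ℝ ↦ ENNReal.ofReal (r ^ (Module.finrank ℝ E - 1)) * g r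

/-- The Mellin transform of `f` at `p`, as an extended nonnegative number. -/
noncomputable def lmellin (f : ℝ → ℝ) (p : ℝ) : ℝ≥0∞ :=
  ∫⁻ t in Set.Ioi (0 : ℝ), ENNReal.ofReal (t ^ (p - 1) * f t)

theorem lmellin_comp_mul_right (f : ℝ → ℝ) (p : ℝ) {s : ℝ} (hs : 0 < s) :
    lmellin (fun t ↦ f (t * s)) p = ENNReal.ofReal (s ^ (-p)) * lmellin f p := by
  have himage : (fun t : ℝ ↦ t * s) '' Set.Ioi 0 = Set.Ioi 0 := by
    simpa [mul_comm] using Set.image_const_mul_Ioi_zero hs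
  have hsubst := lintegral_image_eq_lintegral_abs_deriv_mul
    (f' := fun _ ↦ s) (measurableSet_Ioi (a := 0))
    (fun t _ ↦ by simpa using ((hasDerivAt_id t).mul_const s).hasDerivWithinAt)
    (fun a _ b _ h ↦ mul_right_cancel₀ hs.ne' h)
    fun t ↦ ENNReal.ofReal (t ^ (p - 1) * f t)
  rw [himage] at hsubst
  rw [lmellin, lmellin, hsubst, ← lintegral_const_mul' _ _ ENNReal.ofReal_ne_top]
  refine setLIntegral_congr_fun measurableSet_Ioi fun t ht ↦ ?_
  have ht : 0 < t := ht
  rw [← ENNReal.ofReal_mul (abs_nonneg _), ← ENNReal.ofReal_mul (by positivity), abs_of_pos hs,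
    Real.mul_rpow ht.le hs.le]
  congr 1
  have h : s ^ (-p) * s * s ^ (p - 1) = 1 := by
    nth_rewrite 2 [← Real.rpow_one s]
    rw [← Real.rpow_add hs, ← Real.rpow_add hs]
    ring_nf
    exact Real.rpow_zero s
  linear_combination (-(t ^ (p - 1) * f (t * s))) * h

theorem lmellin_eq_lintegral_sq (f : ℝ → ℝ) (p : ℝ) :
    lmellin f p =
      2 * ∫⁻ r in Set.Ioi (0 : ℝ), ENNReal.ofReal (r ^ (2 * p - 1) * f (r ^ 2)) := by
  have himage : (fun r : ℝ ↦ r ^ 2) '' Set.Ioi 0 = Set.Ioi 0 := by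
    ext t
    refine ⟨?_, fun ht ↦ ⟨√t, Real.sqrt_pos.2 ht, Real.sq_sqrt (le_of_lt ht)⟩⟩
    rintro ⟨r, hr, rfl⟩
    exact pow_pos (Set.mem_Ioi.1 hr) 2
  rw [lmellin, ← himage, lintegral_image_eq_lintegral_abs_deriv_mul
    (f' := fun r ↦ 2 * r) measurableSet_Ioi
    (fun t _ ↦ by simpa using (hasDerivAt_pow 2 t).hasDerivWithinAt)
    (fun a ha b hb h ↦ (sq_eq_sq₀ (le_of_lt ha) (le_of_lt hb)).1 h), himage,
    ← lintegral_const_mul' _ _ ENNReal.ofNat_ne_top]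
  refine setLIntegral_congr_fun measurableSet_Ioi fun r hr ↦ ?_
  have hr : 0 < r := hr
  rw [← ENNReal.ofReal_ofNat, ← ENNReal.ofReal_mul (abs_nonneg _),
    ← ENNReal.ofReal_mul (by positivity), abs_of_pos (by positivity)]
  congr 1
  have h : r * (r ^ 2) ^ (p - 1) = r ^ (2 * p - 1) := by
    rw [← Real.rpow_natCast, ← Real.rpow_mul hr.le]
    nth_rewrite 1 [← Real.rpow_one r]
    rw [← Real.rpow_add hr]
    congr 1
    push_cast
    ring
  linear_combination 2 * f (r ^ 2) * h

theorem two_mul_nuMoment {n : ℕ} (hn : 0 < n) (ν : ℝ) {f : ℝ → ℝ} (hf : Measurable f) :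
    2 * nuMoment n ν f =
      (volume : Measure (EuclideanSpace ℝ (Fin n))).toSphere Set.univ
        * lmellin f ((n + ν) / 2) := by
  have : Nonempty (Fin n) := ⟨⟨0, hn⟩⟩
  rw [nuMoment, lintegral_fun_norm_addHaar volume
    (g := fun r ↦ ENNReal.ofReal (r ^ ν * f (r ^ 2))) (by fun_prop), lmellin_eq_lintegral_sq,
    mul_left_comm]
  congr 2
  refine setLIntegral_congr_fun measurableSet_Ioi fun r hr ↦ ?_
  have hr : 0 < r := hr
  rw [← ENNReal.ofReal_mul (by positivity), ← mul_assoc, ← Real.rpow_natCast,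
    ← Real.rpow_add hr, finrank_euclideanSpace_fin, Nat.cast_pred hn]
  congr 3
  ring

theorem lmellin_gaussDensity_ne_zero (n : ℕ) (p : ℝ) : lmellin (gaussDensity n) p ≠ 0 := by
  have hmeas : Measurable fun t : ℝ ↦ ENNReal.ofReal (t ^ (p - 1) * gaussDensity n t) := by
    unfold gaussDensity
    fun_prop
  rw [lmellin, ← pos_iff_ne_zero, setLIntegral_pos_iff hmeas]
  refine lt_of_lt_of_le ?_ (measure_mono (s := Set.Ioi 0) fun t ht ↦ ⟨?_, ht⟩)
  · simp
  · have ht : 0 < t := ht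
    simp only [Function.mem_support, ne_eq, ENNReal.ofReal_eq_zero, not_le, gaussDensity]
    positivity

theorem lmellin_gaussDensity_ne_top (n : ℕ) {p : ℝ} (hp : 0 < p) :
    lmellin (gaussDensity n) p ≠ ⊤ := by
  have h := (integrableOn_rpow_mul_exp_neg_mul_rpow (s := p - 1) (p := 1) (b := 1 / 2)
    (by linarith) one_pos (by norm_num)).const_mul ((2 * Real.pi) ^ (-(n : ℝ) / 2))
  refine ne_of_eq_of_ne ?_ h.lintegral_lt_top.ne
  refine setLIntegral_congr_fun measurableSet_Ioi fun t _ ↦ ?_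
  simp only [gaussDensity, Real.rpow_one]
  ring_nf

/-- If the centred response is outside the column space of a centred design, every residual
vector of the regression with intercept is nonzero. -/
theorem sum_sq_residual_pos {n : ℕ} {ι : Type} [Fintype ι] (hn : 0 < n)
    (X : Matrix (Fin n) ι ℝ) (horth : Xᵀ.mulVec (fun _ => 1) = 0) (y : Fin n → ℝ)
    (hcol : ∀ β : ι → ℝ, (fun i => y i - (∑ j, y j) / n) ≠ X.mulVec β) (α : ℝ) (β : ι → ℝ) :
    0 < ∑ i, (y i - α - X.mulVec β i) ^ 2 := by
  refine (Finset.sum_nonneg fun i _ ↦ sq_nonneg _).lt_of_ne' fun h ↦ hcol β ?_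
  rw [Finset.sum_eq_zero_iff_of_nonneg fun i _ ↦ sq_nonneg _] at h
  have hres : ∀ i, y i = α + X.mulVec β i := fun i ↦ by
    linarith [pow_eq_zero_iff two_ne_zero |>.1 (h i (Finset.mem_univ i))]
  have hsum : ∑ i, X.mulVec β i = 0 := by
    have : (fun _ ↦ 1) ⬝ᵥ X.mulVec β = 0 := by
      rw [dotProduct_mulVec, ← mulVec_transpose, horth, zero_dotProduct]
    simpa [dotProduct] using this
  have hn' : (n : ℝ) ≠ 0 := by positivity
  have hmean : (∑ j, y j) / n = α := by
    simp only [hres, Finset.sum_add_distrib, hsum]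
    simp [hn']
  funext i
  rw [hmean, hres i]
  ring

/-- The marginal depends on `f` only through its Mellin transform at `(n + ν) / 2`. -/
theorem exists_subharmonicMarginal_eq_mul_lmellin {n : ℕ} {ι : Type} [Fintype ι] [DecidableEq ι]
    (X : Matrix (Fin n) ι ℝ) (y : Fin n → ℝ) (ν : ℝ)
    (hres : ∀ (α : ℝ) (β : ι → ℝ), 0 < ∑ i, (y i - α - X.mulVec β i) ^ 2) :
    ∃ K : ℝ≥0∞, ∀ f : ℝ → ℝ, (∀ t, 0 ≤ f t) → lmellin f ((n + ν) / 2) ≠ ⊤ →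
      subharmonicMarginal n X y ν f = K * lmellin f ((n + ν) / 2) := by
  set p : ℝ := (n + ν) / 2 with hp
  let c : (ι → ℝ) → ℝ := fun β ↦
    (Real.Gamma (((Fintype.card ι : ℝ) - ν) / 2)
          / (2 ^ (ν / 2) * Real.pi ^ ((Fintype.card ι : ℝ) / 2)))
      * (Xᵀ * X).det ^ ((1:ℝ) / 2)
      * (β ⬝ᵥ (Xᵀ * X).mulVec β) ^ (-((Fintype.card ι : ℝ) - ν) / 2)
  refine ⟨∫⁻ α : ℝ, ∫⁻ β : ι → ℝ, ENNReal.ofReal (c β) *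
    ENNReal.ofReal ((∑ i, (y i - α - X.mulVec β i) ^ 2) ^ (-p)), fun f hf hfin ↦ ?_⟩
  rw [subharmonicMarginal, ← lintegral_mul_const' _ _ hfin]
  refine lintegral_congr fun α ↦ ?_
  rw [← lintegral_mul_const' _ _ hfin]
  refine lintegral_congr fun β ↦ ?_
  rw [mul_assoc, ← lmellin_comp_mul_right f p (hres α β), lmellin,
    ← lintegral_const_mul' _ _ ENNReal.ofReal_ne_top]
  refine setLIntegral_congr_fun measurableSet_Ioi fun η hη ↦ ?_
  have hη : 0 < η := hη
  rw [mul_comm (ENNReal.ofReal (c β)),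
    ← ENNReal.ofReal_mul (mul_nonneg (by positivity) (hf _))]
  congr 1
  have h : η ^ ((n : ℝ) / 2) * η ^ (ν / 2 - 1) = η ^ (p - 1) := by
    rw [← Real.rpow_add hη, hp]
    ring_nf
  rw [← h]
  ring

theorem gaussDensity_nonneg (n : ℕ) (t : ℝ) : 0 ≤ gaussDensity n t := by
  unfold gaussDensity
  positivity

theorem measurable_gaussDensity (n : ℕ) : Measurable (gaussDensity n) := by
  unfold gaussDensity
  fun_prop

/-- **Lemma 1, robustness of the marginal.** Under the regression setup,
the marginal of `y` under the sub-harmonic prior and spherically symmetric error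
density `f` equals `(E_f / E_G)` times the Gaussian marginal. -/
theorem subharmonicMarginal_robust
    (n q : ℕ) (hn : q + 1 < n)
    (X : Matrix (Fin n) (Fin q) ℝ) (hrank : X.rank = q)
    (horth : Xᵀ.mulVec (fun _ => 1) = 0)
    (y : Fin n → ℝ)
    (hy : (fun i => y i - (∑ j, y j) / n) ≠ 0)
    (hcol : ∀ β : Fin q → ℝ, (fun i => y i - (∑ j, y j) / n) ≠ X.mulVec β)
    (f : ℝ → ℝ) (hmeas : Measurable f) (hpos : ∀ t, 0 ≤ f t)
    (hdens : (∫⁻ x : EuclideanSpace ℝ (Fin n), ENNReal.ofReal (f (‖x‖ ^ 2))) = 1)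
    (ν : ℝ) (hν0 : 0 < ν) (hνq : ν < q)
    (hmom : nuMoment n ν f < ⊤) :
    subharmonicMarginal n X y ν f
      = (nuMoment n ν f / nuMoment n ν (gaussDensity n))
          * subharmonicMarginal n X y ν (gaussDensity n) := by
  have hn0 : 0 < n := by omega
  have : Nonempty (Fin n) := ⟨⟨0, hn0⟩⟩
  have hp : 0 < ((n : ℝ) + ν) / 2 := by positivity
  obtain ⟨K, hK⟩ := exists_subharmonicMarginal_eq_mul_lmellin X y ν
    (sum_sq_residual_pos hn0 X horth y hcol)
  set σ := (volume : Measure (EuclideanSpace ℝ (Fin n))).toSphere Set.univ with hσ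
  have hσ0 : σ ≠ 0 := Measure.measure_univ_ne_zero.2 (Measure.toSphere_ne_zero _)
  have hσt : σ ≠ ⊤ := measure_ne_top _ _
  have hEf := two_mul_nuMoment hn0 ν hmeas
  have hEG := two_mul_nuMoment hn0 ν (measurable_gaussDensity n)
  have hG0 := lmellin_gaussDensity_ne_zero n (((n : ℝ) + ν) / 2)
  have hGt := lmellin_gaussDensity_ne_top n hp
  have hft : lmellin f ((n + ν) / 2) ≠ ⊤ := by
    intro h
    rw [← hσ, h, ENNReal.mul_top hσ0] at hEf
    exact ENNReal.mul_ne_top ENNReal.ofNat_ne_top hmom.ne hEf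
  rw [hK f hpos hft, hK _ (gaussDensity_nonneg n) hGt,
    ← ENNReal.mul_div_mul_left _ _ two_ne_zero ENNReal.ofNat_ne_top, hEf, hEG,
    ENNReal.mul_div_mul_left _ _ hσ0 hσt, mul_left_comm, ENNReal.div_mul_cancel hG0 hGt]
end

section
/- (Lemma 2, Gaussian marginal in closed form.) Under the regression setup with design matrix X (n×q) and response y, let 0 < ν < q and let f_G(t) = (2π)^{−n/2} e^{−t/2}. Then the marginal density of y under the sub-harmonic prior and Gaussian errors equals M_{f_G}(y|ν) = [n^{−1/2} Γ((n−1)/2) / (‖y − ȳ1_n‖^{n−1} π^{(n−1)/2})] · ∫₀^∞ g^{ν/2−1} (1+g)^{(n−q−1)/2} (g(1−R²)+1)^{−(n−1)/2} dg, where R² is the coefficient of determination of the model with design X; moreover the g-integral on the right-hand side is finite. -/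
open MeasureTheory Matrix ENNReal

/-- The coefficient of determination `R² = ‖X(XᵀX)⁻¹Xᵀ(y-ȳ1)‖²/‖y-ȳ1‖²`. -/
noncomputable def coeffDet (n : ℕ) {ι : Type} [Fintype ι] [DecidableEq ι]
    (X : Matrix (Fin n) ι ℝ) (y : Fin n → ℝ) : ℝ :=
  (∑ i, (X.mulVec ((Xᵀ * X)⁻¹.mulVec (Xᵀ.mulVec (fun j => y j - (∑ l, y l) / n))) i) ^ 2)
    / (∑ i, (y i - (∑ l, y l) / n) ^ 2)

theorem lintegral_rpow_mul_exp_neg_mul_Ioi {a r : ℝ} (ha : 0 < a) (hr : 0 < r) :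
    ∫⁻ x in Set.Ioi (0 : ℝ), ENNReal.ofReal (x ^ (a - 1) * Real.exp (-(r * x)))
      = ENNReal.ofReal (r ^ (-a) * Real.Gamma a) := by
  have hint : IntegrableOn (fun x : ℝ => x ^ (a - 1) * Real.exp (-(r * x))) (Set.Ioi 0) := by
    simpa using integrableOn_rpow_mul_exp_neg_mul_rpow (p := 1) (s := a - 1) (by linarith)
      one_pos hr
  rw [← ofReal_integral_eq_lintegral_ofReal hint, Real.integral_rpow_mul_exp_neg_mul_Ioi ha hr,
    one_div, Real.inv_rpow hr.le, Real.rpow_neg hr.le]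
  filter_upwards [ae_restrict_mem measurableSet_Ioi] with x hx
  have : 0 < x := hx
  simp only [Pi.zero_apply]
  positivity

theorem lintegral_rpow_mul_exp_neg_div_Ioi {a r : ℝ} (ha : 0 < a) (hr : 0 < r) :
    ∫⁻ x in Set.Ioi (0 : ℝ), ENNReal.ofReal (x ^ (-a - 1) * Real.exp (-(r / x)))
      = ENNReal.ofReal (r ^ (-a) * Real.Gamma a) := by
  rw [← lintegral_rpow_mul_exp_neg_mul_Ioi ha hr]
  have himage : (fun x : ℝ => x⁻¹) '' Set.Ioi 0 = Set.Ioi 0 := by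
    rw [Set.image_inv_eq_inv]
    ext x
    simp
  conv_lhs => rw [← himage]
  rw [lintegral_image_eq_lintegral_abs_deriv_mul measurableSet_Ioi
    (fun x hx => (hasDerivAt_inv (ne_of_gt hx)).hasDerivWithinAt) inv_injective.injOn]
  refine setLIntegral_congr_fun measurableSet_Ioi fun x hx => ?_
  have hx : 0 < x := hx
  rw [← ENNReal.ofReal_mul (abs_nonneg _), ← mul_assoc, div_inv_eq_mul, abs_neg,
    abs_of_pos (by positivity), Real.inv_rpow hx.le, ← Real.rpow_neg hx.le,
    ← Real.rpow_natCast, ← Real.rpow_neg hx.le, ← Real.rpow_add hx]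
  congr 3
  push_cast
  ring

theorem lintegral_exp_neg_mul_sub_sq {b : ℝ} (hb : 0 < b) (c : ℝ) :
    ∫⁻ x : ℝ, ENNReal.ofReal (Real.exp (-b * (x - c) ^ 2))
      = ENNReal.ofReal ((Real.pi / b) ^ ((1 : ℝ) / 2)) := by
  rw [lintegral_sub_right_eq_self (fun x : ℝ => ENNReal.ofReal (Real.exp (-b * x ^ 2))) c,
    ← ofReal_integral_eq_lintegral_ofReal (integrable_exp_neg_mul_sq hb)
      (Filter.Eventually.of_forall fun x => (Real.exp_pos _).le),
    integral_gaussian, Real.sqrt_eq_rpow]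

theorem lintegral_pi_exp_neg_mul_sum_sq {ι : Type*} [Fintype ι] {b : ℝ} (hb : 0 < b) :
    ∫⁻ x : ι → ℝ, ENNReal.ofReal (Real.exp (-b * ∑ i, x i ^ 2))
      = ENNReal.ofReal ((Real.pi / b) ^ ((Fintype.card ι : ℝ) / 2)) := by
  have hprod (x : ι → ℝ) : Real.exp (-b * ∑ i, x i ^ 2) = ∏ i, Real.exp (-b * x i ^ 2) := by
    rw [← Real.exp_sum, Finset.mul_sum]
  have hint : Integrable fun x : ι → ℝ => ∏ i, Real.exp (-b * x i ^ 2) :=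
    Integrable.fintype_prod fun _ => integrable_exp_neg_mul_sq hb
  simp_rw [hprod]
  rw [← ofReal_integral_eq_lintegral_ofReal hint
      (Filter.Eventually.of_forall fun x => Finset.prod_nonneg fun i _ => (Real.exp_pos _).le),
    integral_fintype_prod_volume_eq_pow (fun x : ℝ => Real.exp (-b * x ^ 2)), integral_gaussian,
    Real.sqrt_eq_rpow, ← Real.rpow_natCast, ← Real.rpow_mul (by positivity)]
  congr 2
  ring

open scoped MatrixOrder ComplexOrder in
theorem lintegral_exp_neg_mul_posDef {ι : Type*} [Fintype ι] [DecidableEq ι]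
    {A : Matrix ι ι ℝ} (hA : A.PosDef) {c : ℝ} (hc : 0 < c) (b : ι → ℝ) :
    ∫⁻ x : ι → ℝ, ENNReal.ofReal (Real.exp (-c * ((x - b) ⬝ᵥ A *ᵥ (x - b))))
      = ENNReal.ofReal ((Real.pi / c) ^ ((Fintype.card ι : ℝ) / 2) * A.det ^ (-(1 : ℝ) / 2)) := by
  rw [lintegral_sub_right_eq_self
    (fun x : ι → ℝ => ENNReal.ofReal (Real.exp (-c * (x ⬝ᵥ A *ᵥ x)))) b]
  obtain ⟨B, hB⟩ := CStarAlgebra.nonneg_iff_eq_star_mul_self.mp hA.posSemidef.nonneg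
  replace hB : A = Bᵀ * B := by simpa [star_eq_conjTranspose] using hB
  have hdet : A.det = B.det ^ 2 := by rw [hB, det_mul, det_transpose, sq]
  have hB0 : B.det ≠ 0 := fun h => hA.det_pos.ne' (by simp [hdet, h])
  have hquad (x : ι → ℝ) : x ⬝ᵥ A *ᵥ x = ∑ i, (toLin' B x) i ^ 2 := by
    rw [hB, ← mulVec_mulVec, dotProduct_mulVec, vecMul_transpose]
    simp [dotProduct, sq]
  simp_rw [hquad]
  rw [← lintegral_map (μ := volume) (g := toLin' B)
      (f := fun x : ι → ℝ => ENNReal.ofReal (Real.exp (-c * ∑ i, x i ^ 2))) (by fun_prop)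
      (LinearMap.continuous_of_finiteDimensional _).measurable,
    Real.map_matrix_volume_pi_eq_smul_volume_pi hB0, lintegral_smul_measure,
    lintegral_pi_exp_neg_mul_sum_sq hc, smul_eq_mul, ← ENNReal.ofReal_mul (by positivity), mul_comm,
    hdet, ← sq_abs, ← Real.rpow_natCast, ← Real.rpow_mul (abs_nonneg _), abs_inv,
    ← Real.rpow_neg_one]
  norm_num

theorem lintegral_rotate₄ {α β γ δ : Type*} [MeasurableSpace α] [MeasurableSpace β]
    [MeasurableSpace γ] [MeasurableSpace δ] {μ : Measure α} {ν : Measure β} {ρ : Measure γ}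
    {τ : Measure δ} [SFinite μ] [SFinite ν] [SFinite ρ] [SFinite τ]
    {F : α → β → γ → δ → ℝ≥0∞}
    (hF : Measurable fun p : α × β × γ × δ => F p.1 p.2.1 p.2.2.1 p.2.2.2) :
    ∫⁻ a, ∫⁻ b, ∫⁻ c, ∫⁻ d, F a b c d ∂τ ∂ρ ∂ν ∂μ
      = ∫⁻ d, ∫⁻ c, ∫⁻ b, ∫⁻ a, F a b c d ∂μ ∂ν ∂ρ ∂τ := by
  have h1 : ∫⁻ a, ∫⁻ b, ∫⁻ c, ∫⁻ d, F a b c d ∂τ ∂ρ ∂ν ∂μ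
      = ∫⁻ p, F p.1 p.2.1 p.2.2.1 p.2.2.2 ∂(μ.prod (ν.prod (ρ.prod τ))) := by
    rw [lintegral_prod _ hF.aemeasurable]
    refine lintegral_congr fun a => ?_
    have ha : Measurable fun p : β × γ × δ => F a p.1 p.2.1 p.2.2 :=
      hF.comp measurable_prodMk_left
    rw [lintegral_prod _ ha.aemeasurable]
    refine lintegral_congr fun b => ?_
    have hb : Measurable fun p : γ × δ => F a b p.1 p.2 := ha.comp measurable_prodMk_left
    rw [lintegral_prod _ hb.aemeasurable]
  have hm : Measurable fun r : α × (β × (γ × δ)) => F r.1 r.2.1 r.2.2.1 r.2.2.2 := hF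
  have hbcd : Measurable fun r : β × (γ × δ) => ∫⁻ a, F a r.1 r.2.1 r.2.2 ∂μ :=
    hm.lintegral_prod_left'
  have hcd : Measurable fun r : γ × δ => ∫⁻ b, ∫⁻ a, F a b r.1 r.2 ∂μ ∂ν :=
    hbcd.lintegral_prod_left'
  rw [h1, lintegral_prod_symm' _ hm, lintegral_prod_symm' _ hbcd, lintegral_prod_symm' _ hcd]

theorem setLIntegral_marginal_integrand_lt_top {ν q m δ : ℝ} (hν : 0 < ν) (hνq : ν < q)
    (hm : 0 ≤ m) (hδ0 : 0 < δ) (hδ1 : δ ≤ 1) :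
    ∫⁻ g in Set.Ioi (0 : ℝ), ENNReal.ofReal (g ^ (ν / 2 - 1) * (1 + g) ^ ((m - q) / 2)
      * (g * δ + 1) ^ (-m / 2)) < ⊤ := by
  have hbound {g : ℝ} (hg : 0 < g) : (1 + g) ^ ((m - q) / 2) * (g * δ + 1) ^ (-m / 2)
      ≤ δ ^ (-m / 2) * (1 + g) ^ (-q / 2) := by
    have h1 : (g * δ + 1) ^ (-m / 2) ≤ (δ * (1 + g)) ^ (-m / 2) :=
      Real.rpow_le_rpow_of_nonpos (by positivity) (by nlinarith) (by linarith)
    calc _ ≤ (1 + g) ^ ((m - q) / 2) * (δ * (1 + g)) ^ (-m / 2) := by gcongr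
      _ = δ ^ (-m / 2) * ((1 + g) ^ ((m - q) / 2) * (1 + g) ^ (-m / 2)) := by
        rw [Real.mul_rpow hδ0.le (by positivity)]; ring
      _ = _ := by
        rw [← Real.rpow_add (by positivity)]; congr 2; ring
  have hfin {s : Set ℝ} (hs : MeasurableSet s) {t : ℝ}
      (hle : ∀ g ∈ s, 0 < g ∧ (1 + g) ^ (-q / 2) * g ^ (ν / 2 - 1) ≤ g ^ t)
      (hint : IntegrableOn (fun g : ℝ => g ^ t) s) :
      ∫⁻ g in s, ENNReal.ofReal (g ^ (ν / 2 - 1) * (1 + g) ^ ((m - q) / 2)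
        * (g * δ + 1) ^ (-m / 2)) < ⊤ := by
    refine lt_of_le_of_lt (setLIntegral_mono' hs fun g hg => ?_)
      (hint.const_mul (δ ^ (-m / 2))).lintegral_lt_top
    obtain ⟨hg0, hgt⟩ := hle g hg
    refine ENNReal.ofReal_le_ofReal ?_
    calc _ = g ^ (ν / 2 - 1) * ((1 + g) ^ ((m - q) / 2) * (g * δ + 1) ^ (-m / 2)) := by ring
      _ ≤ g ^ (ν / 2 - 1) * (δ ^ (-m / 2) * (1 + g) ^ (-q / 2)) := 
        mul_le_mul_of_nonneg_left (hbound hg0) (by positivity)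
      _ = δ ^ (-m / 2) * ((1 + g) ^ (-q / 2) * g ^ (ν / 2 - 1)) := by ring
      _ ≤ _ := by gcongr
  rw [← Set.Ioc_union_Ioi_eq_Ioi zero_le_one]
  refine (lintegral_union_le _ _ _).trans_lt (ENNReal.add_lt_top.2 ⟨?_, ?_⟩)
  · refine hfin measurableSet_Ioc (t := ν / 2 - 1) (fun g hg => ⟨hg.1, ?_⟩)
      ((intervalIntegrable_iff_integrableOn_Ioc_of_le zero_le_one).1
        (intervalIntegral.intervalIntegrable_rpow' (by linarith)))
    have := Real.rpow_pos_of_pos hg.1 (ν / 2 - 1)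
    exact mul_le_of_le_one_left this.le
      (Real.rpow_le_one_of_one_le_of_nonpos (by linarith [hg.1]) (by linarith))
  · refine hfin measurableSet_Ioi (t := -q / 2 + (ν / 2 - 1)) (fun g hg => ?_)
      (integrableOn_Ioi_rpow_of_lt (by linarith) one_pos)
    have hg0 : 0 < g := one_pos.trans hg
    refine ⟨hg0, ?_⟩
    rw [Real.rpow_add hg0]
    gcongr ?_ * _
    exact Real.rpow_le_rpow_of_nonpos hg0 (by linarith) (by linarith)

theorem mulVec_injective_of_rank_eq_card {m ι : Type*} [Fintype m] [Fintype ι]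
    {X : Matrix m ι ℝ} (hX : X.rank = Fintype.card ι) : Function.Injective X.mulVec := by
  have h := X.mulVecLin.finrank_range_add_finrank_ker
  rw [Module.finrank_fintype_fun_eq_card, ← hX, Matrix.rank, Nat.add_eq_left,
    Submodule.finrank_eq_zero, LinearMap.ker_eq_bot] at h
  exact h

theorem posDef_transpose_mul_self_of_rank_eq_card {m ι : Type*} [Fintype m] [Fintype ι]
    {X : Matrix m ι ℝ} (hX : X.rank = Fintype.card ι) : (Xᵀ * X).PosDef := by
  simpa using PosDef.conjTranspose_mul_self X (mulVec_injective_of_rank_eq_card hX)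

theorem dotProduct_transpose_mul_self_mulVec {m ι : Type*} [Fintype m] [Fintype ι]
    (X : Matrix m ι ℝ) (β γ : ι → ℝ) :
    β ⬝ᵥ (Xᵀ * X) *ᵥ γ = (X *ᵥ β) ⬝ᵥ (X *ᵥ γ) := by
  rw [← mulVec_mulVec, dotProduct_mulVec, vecMul_transpose]

theorem mulVec_dotProduct_leastSquares {m ι : Type*} [Fintype m] [Fintype ι] [DecidableEq ι]
    {X : Matrix m ι ℝ} (hX : IsUnit (Xᵀ * X).det) (β : ι → ℝ) (v : m → ℝ) :
    (X *ᵥ β) ⬝ᵥ (X *ᵥ ((Xᵀ * X)⁻¹ *ᵥ (Xᵀ *ᵥ v))) = (X *ᵥ β) ⬝ᵥ v := by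
  rw [← dotProduct_transpose_mul_self_mulVec, mulVec_mulVec, mul_nonsing_inv _ hX, one_mulVec,
    dotProduct_mulVec, vecMul_transpose]

theorem sum_sq_residual_add_penalty {n : ℕ} {ι : Type*} [Fintype ι] [DecidableEq ι] (hn : n ≠ 0)
    {X : Matrix (Fin n) ι ℝ} (hX : IsUnit (Xᵀ * X).det) (horth : Xᵀ *ᵥ (fun _ => 1) = 0)
    (y : Fin n → ℝ) (α : ℝ) (β : ι → ℝ) {g : ℝ} (hg : 0 < g) {v : Fin n → ℝ}
    (hv : v = fun i => y i - (∑ j, y j) / n) {b : ι → ℝ} (hb : b = (Xᵀ * X)⁻¹ *ᵥ (Xᵀ *ᵥ v)) :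
    ∑ i, (y i - α - (X *ᵥ β) i) ^ 2 + (β ⬝ᵥ (Xᵀ * X) *ᵥ β) / g
      = n * (α - (∑ j, y j) / n) ^ 2
        + (∑ i, v i ^ 2 - g / (1 + g) * ∑ i, (X *ᵥ b) i ^ 2)
        + (1 + g) / g * ((β - (g / (1 + g)) • b) ⬝ᵥ (Xᵀ * X) *ᵥ (β - (g / (1 + g)) • b)) := by
  have hn' : (n : ℝ) ≠ 0 := Nat.cast_ne_zero.2 hn
  have hsumv : ∑ i, v i = 0 := by
    simp [hv, Finset.sum_sub_distrib]
    field_simp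
    ring
  have hsumX : ∑ i, (X *ᵥ β) i = 0 := by
    have h : (X *ᵥ β) ⬝ᵥ (fun _ => 1) = 0 := by
      rw [← vecMul_transpose, ← dotProduct_mulVec, horth, dotProduct_zero]
    simpa [dotProduct] using h
  have hnormal := mulVec_dotProduct_leastSquares hX β v
  rw [← hb] at hnormal
  have hexpand : ∑ i, (y i - α - (X *ᵥ β) i) ^ 2 = n * (α - (∑ j, y j) / n) ^ 2
      + v ⬝ᵥ v - 2 * ((X *ᵥ β) ⬝ᵥ v) + (X *ᵥ β) ⬝ᵥ (X *ᵥ β) := by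
    have hterm (i : Fin n) : (y i - α - (X *ᵥ β) i) ^ 2 = (α - (∑ j, y j) / n) ^ 2
        + v i * v i - 2 * ((X *ᵥ β) i * v i) + (X *ᵥ β) i * (X *ᵥ β) i
        - 2 * (α - (∑ j, y j) / n) * (v i - (X *ᵥ β) i) := by
      rw [hv]; ring
    simp_rw [hterm, Finset.sum_sub_distrib, Finset.sum_add_distrib, ← Finset.mul_sum,
      Finset.sum_sub_distrib, hsumv, hsumX, dotProduct, ← Finset.mul_sum]
    simp [Finset.sum_add_distrib]
  have hvv : ∑ i, v i ^ 2 = v ⬝ᵥ v := by simp [dotProduct, sq]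
  have hbb : ∑ i, (X *ᵥ b) i ^ 2 = (X *ᵥ b) ⬝ᵥ (X *ᵥ b) := by simp [dotProduct, sq]
  rw [hexpand, hvv, hbb, dotProduct_transpose_mul_self_mulVec,
    dotProduct_transpose_mul_self_mulVec, mulVec_sub, mulVec_smul, ← hnormal]
  simp only [sub_dotProduct, dotProduct_sub, smul_dotProduct, dotProduct_smul, smul_eq_mul,
    dotProduct_comm (X *ᵥ b) (X *ᵥ β)]
  field_simp
  ring

theorem sum_sq_fitted_lt {n : ℕ} {ι : Type*} [Fintype ι] [DecidableEq ι]
    {X : Matrix (Fin n) ι ℝ} (hX : IsUnit (Xᵀ * X).det) {v : Fin n → ℝ}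
    (hv : ∀ β : ι → ℝ, v ≠ X *ᵥ β) :
    ∑ i, (X *ᵥ ((Xᵀ * X)⁻¹ *ᵥ (Xᵀ *ᵥ v))) i ^ 2 < ∑ i, v i ^ 2 := by
  set b := (Xᵀ * X)⁻¹ *ᵥ (Xᵀ *ᵥ v) with hb
  have hnormal : (X *ᵥ b) ⬝ᵥ (X *ᵥ b) = (X *ᵥ b) ⬝ᵥ v := mulVec_dotProduct_leastSquares hX b v
  have hpos : 0 < (v - X *ᵥ b) ⬝ᵥ (v - X *ᵥ b) := by
    refine lt_of_le_of_ne (Finset.sum_nonneg fun i _ => mul_self_nonneg _) fun h => ?_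
    exact hv b (sub_eq_zero.1 (dotProduct_self_eq_zero.1 h.symm))
  simp only [sub_dotProduct, dotProduct_sub, dotProduct_comm v (X *ᵥ b)] at hpos
  have hvv : ∑ i, v i ^ 2 = v ⬝ᵥ v := by simp [dotProduct, sq]
  have hbb : ∑ i, (X *ᵥ b) i ^ 2 = (X *ᵥ b) ⬝ᵥ (X *ᵥ b) := by simp [dotProduct, sq]
  rw [hvv, hbb]
  linarith

theorem subharmonic_integrand_eq_lintegral {n q ν D T Q η : ℝ} (hνq : ν < q) (hD : 0 < D)
    (hQ : 0 < Q) (hη : 0 < η) :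
    ENNReal.ofReal (η ^ (n / 2) * ((2 * Real.pi) ^ (-n / 2) * Real.exp (-(η * T) / 2))
        * (Real.Gamma ((q - ν) / 2) / (2 ^ (ν / 2) * Real.pi ^ (q / 2)))
        * D ^ ((1 : ℝ) / 2) * Q ^ (-(q - ν) / 2) * η ^ (ν / 2 - 1))
      = ∫⁻ g in Set.Ioi (0 : ℝ), ENNReal.ofReal
          ((2 * Real.pi) ^ (-(n + q) / 2) * D ^ ((1 : ℝ) / 2) * η ^ ((n + q) / 2 - 1)
            * g ^ (-((q - ν) / 2) - 1) * Real.exp (-(η / 2) * (T + Q / g))) := by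
  have ha : 0 < (q - ν) / 2 := by linarith
  have hr : 0 < η * Q / 2 := by positivity
  have hΓ := Real.Gamma_pos_of_pos ha
  have hsplit (g : ℝ) :
      (2 * Real.pi) ^ (-(n + q) / 2) * D ^ ((1 : ℝ) / 2) * η ^ ((n + q) / 2 - 1)
          * g ^ (-((q - ν) / 2) - 1) * Real.exp (-(η / 2) * (T + Q / g))
        = ((2 * Real.pi) ^ (-(n + q) / 2) * D ^ ((1 : ℝ) / 2) * η ^ ((n + q) / 2 - 1)
          * Real.exp (-(η / 2) * T))
          * (g ^ (-((q - ν) / 2) - 1) * Real.exp (-(η * Q / 2 / g))) := by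
    rw [show -(η / 2) * (T + Q / g) = -(η / 2) * T + -(η * Q / 2 / g) by ring, Real.exp_add]
    ring
  simp_rw [hsplit]
  simp_rw [ENNReal.ofReal_mul (show 0 ≤ (2 * Real.pi) ^ (-(n + q) / 2) * D ^ ((1 : ℝ) / 2)
    * η ^ ((n + q) / 2 - 1) * Real.exp (-(η / 2) * T) by positivity)]
  rw [lintegral_const_mul' _ _ ENNReal.ofReal_ne_top, lintegral_rpow_mul_exp_neg_div_Ioi ha hr,
    ← ENNReal.ofReal_mul (by positivity)]
  congr 1
  refine Real.log_injOn_pos (Set.mem_Ioi.2 (by positivity)) (Set.mem_Ioi.2 (by positivity)) ?_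
  simp (disch := positivity) only [Real.log_mul, Real.log_div, Real.log_rpow, Real.log_exp]
  ring

theorem lintegral_lintegral_exp_neg_quadratic {ι : Type*} [Fintype ι] [DecidableEq ι]
    {A : Matrix ι ι ℝ} (hA : A.PosDef) {k c : ℝ} (hk : 0 < k) (hc : 0 < c) (m : ℝ) (b : ι → ℝ)
    {w : ℝ} (hw : 0 ≤ w) :
    ∫⁻ β : ι → ℝ, ∫⁻ α : ℝ, ENNReal.ofReal
        (w * (Real.exp (-k * (α - m) ^ 2) * Real.exp (-c * ((β - b) ⬝ᵥ A *ᵥ (β - b)))))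
      = ENNReal.ofReal (w * ((Real.pi / k) ^ ((1 : ℝ) / 2)
          * ((Real.pi / c) ^ ((Fintype.card ι : ℝ) / 2) * A.det ^ (-(1 : ℝ) / 2)))) := by
  have hdet := hA.det_pos
  simp_rw [ENNReal.ofReal_mul hw, ENNReal.ofReal_mul (Real.exp_pos _).le]
  simp_rw [lintegral_const_mul' _ _ ENNReal.ofReal_ne_top,
    lintegral_mul_const' _ _ ENNReal.ofReal_ne_top, lintegral_exp_neg_mul_sub_sq hk,
    lintegral_const_mul' _ _ ENNReal.ofReal_ne_top]
  rw [lintegral_exp_neg_mul_posDef hA hc, ← ENNReal.ofReal_mul (by positivity)]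

/-- **Lemma 2, Gaussian marginal in closed form.** Under the regression
setup and Gaussian errors, the marginal of `y` under the sub-harmonic prior equals a
closed-form constant times a finite one-dimensional `g`-integral involving `R²`. -/
theorem subharmonicMarginal_gaussian_closed_form
    (n q : ℕ) (hn : q + 1 < n)
    (X : Matrix (Fin n) (Fin q) ℝ) (hrank : X.rank = q)
    (horth : Xᵀ.mulVec (fun _ => 1) = 0)
    (y : Fin n → ℝ)
    (hy : (fun i => y i - (∑ j, y j) / n) ≠ 0)
    (hcol : ∀ β : Fin q → ℝ, (fun i => y i - (∑ j, y j) / n) ≠ X.mulVec β)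
    (ν : ℝ) (hν0 : 0 < ν) (hνq : ν < q) :
    (subharmonicMarginal n X y ν (gaussDensity n)
      = ENNReal.ofReal ((n : ℝ) ^ (-(1:ℝ) / 2) * Real.Gamma (((n : ℝ) - 1) / 2)
            / ((∑ i, (y i - (∑ j, y j) / n) ^ 2) ^ (((n : ℝ) - 1) / 2)
                * Real.pi ^ (((n : ℝ) - 1) / 2)))
        * ∫⁻ g in Set.Ioi (0:ℝ),
            ENNReal.ofReal (g ^ (ν / 2 - 1) * (1 + g) ^ (((n : ℝ) - q - 1) / 2)
              * (g * (1 - coeffDet n X y) + 1) ^ (-((n : ℝ) - 1) / 2))) ∧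
    (∫⁻ g in Set.Ioi (0:ℝ),
        ENNReal.ofReal (g ^ (ν / 2 - 1) * (1 + g) ^ (((n : ℝ) - q - 1) / 2)
          * (g * (1 - coeffDet n X y) + 1) ^ (-((n : ℝ) - 1) / 2))) < ⊤ := by
  have hn0 : n ≠ 0 := by omega
  have hnpos : (0 : ℝ) < n := by exact_mod_cast Nat.pos_of_ne_zero hn0
  have hnq : (q : ℝ) + 1 < n := by exact_mod_cast hn
  have hq : 0 < q := by exact_mod_cast hν0.trans hνq
  have : Nonempty (Fin q) := ⟨⟨0, hq⟩⟩
  have hcard : X.rank = Fintype.card (Fin q) := by simpa using hrank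
  have hA := posDef_transpose_mul_self_of_rank_eq_card hcard
  have hdet : 0 < (Xᵀ * X).det := hA.det_pos
  have hunit : IsUnit (Xᵀ * X).det := hdet.ne'.isUnit
  have hlt := sum_sq_fitted_lt hunit hcol
  set v : Fin n → ℝ := fun i => y i - (∑ j, y j) / n with hv
  set b := (Xᵀ * X)⁻¹ *ᵥ (Xᵀ *ᵥ v) with hb
  have hP0 : 0 ≤ ∑ i, (X *ᵥ b) i ^ 2 := Finset.sum_nonneg fun i _ => sq_nonneg _
  have hS : 0 < ∑ i, v i ^ 2 := hP0.trans_lt hlt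
  have hR : coeffDet n X y = (∑ i, (X *ᵥ b) i ^ 2) / ∑ i, v i ^ 2 := rfl
  have hR0 : 0 ≤ coeffDet n X y := by rw [hR]; positivity
  have hR1 : coeffDet n X y < 1 := by rw [hR, div_lt_one hS]; exact hlt
  have hP : ∑ i, (X *ᵥ b) i ^ 2 = coeffDet n X y * ∑ i, v i ^ 2 := by
    rw [hR, div_mul_cancel₀ _ hS.ne']
  generalize coeffDet n X y = R at hR0 hR1 hP ⊢
  constructor
  swap
  · have h := setLIntegral_marginal_integrand_lt_top (m := (n : ℝ) - 1) (δ := 1 - R) hν0 hνq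
      (by linarith) (by linarith) (by linarith)
    convert h using 7
    ring
  set S := ∑ i, v i ^ 2 with hSdef
  have hmeas : Measurable fun p : ℝ × (Fin q → ℝ) × ℝ × ℝ => ENNReal.ofReal
      ((2 * Real.pi) ^ (-((n : ℝ) + q) / 2) * (Xᵀ * X).det ^ ((1 : ℝ) / 2)
        * p.2.2.1 ^ (((n : ℝ) + q) / 2 - 1) * p.2.2.2 ^ (-((q - ν) / 2) - 1)
        * Real.exp (-(p.2.2.1 / 2) * (∑ i, (y i - p.1 - (X *ᵥ p.2.1) i) ^ 2
          + (p.2.1 ⬝ᵥ (Xᵀ * X) *ᵥ p.2.1) / p.2.2.2))) := by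
    simp only [dotProduct, mulVec]
    fun_prop
  have hmix : subharmonicMarginal n X y ν (gaussDensity n)
      = ∫⁻ α : ℝ, ∫⁻ β : Fin q → ℝ, ∫⁻ η in Set.Ioi (0 : ℝ), ∫⁻ g in Set.Ioi (0 : ℝ),
        ENNReal.ofReal ((2 * Real.pi) ^ (-((n : ℝ) + q) / 2) * (Xᵀ * X).det ^ ((1 : ℝ) / 2)
          * η ^ (((n : ℝ) + q) / 2 - 1) * g ^ (-((q - ν) / 2) - 1)
          * Real.exp (-(η / 2) * (∑ i, (y i - α - (X *ᵥ β) i) ^ 2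
            + (β ⬝ᵥ (Xᵀ * X) *ᵥ β) / g))) := by
    refine lintegral_congr fun α => lintegral_congr_ae ?_
    have hβ0 : ∀ᵐ β : Fin q → ℝ, β ≠ 0 := by simp [ae_iff]
    filter_upwards [hβ0] with β hβ
    have hQ : 0 < β ⬝ᵥ (Xᵀ * X) *ᵥ β := by simpa using hA.dotProduct_mulVec_pos hβ
    refine setLIntegral_congr_fun measurableSet_Ioi fun η hη => ?_
    rw [← subharmonic_integrand_eq_lintegral hνq hdet hQ hη]
    simp [gaussDensity]
  rw [hmix, lintegral_rotate₄ hmeas, ← lintegral_const_mul' _ _ ENNReal.ofReal_ne_top]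
  refine setLIntegral_congr_fun measurableSet_Ioi fun g hg => ?_
  have hg : 0 < g := hg
  have hδ : 0 < g * (1 - R) + 1 := by nlinarith
  have hs : S - g / (1 + g) * (R * S) = S * (g * (1 - R) + 1) / (1 + g) := by
    field_simp
    ring
  have hinner : ∀ η ∈ Set.Ioi (0 : ℝ), ∫⁻ β : Fin q → ℝ, ∫⁻ α : ℝ,
      ENNReal.ofReal ((2 * Real.pi) ^ (-((n : ℝ) + q) / 2) * (Xᵀ * X).det ^ ((1 : ℝ) / 2)
        * η ^ (((n : ℝ) + q) / 2 - 1) * g ^ (-((q - ν) / 2) - 1)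
        * Real.exp (-(η / 2) * (∑ i, (y i - α - (X *ᵥ β) i) ^ 2
          + (β ⬝ᵥ (Xᵀ * X) *ᵥ β) / g)))
      = ENNReal.ofReal ((2 * Real.pi) ^ (-((n : ℝ) - 1) / 2) * (n : ℝ) ^ (-(1 : ℝ) / 2)
          * g ^ (ν / 2 - 1) * (1 + g) ^ (-(q : ℝ) / 2))
        * ENNReal.ofReal (η ^ (((n : ℝ) - 1) / 2 - 1)
          * Real.exp (-(S * (g * (1 - R) + 1) / (1 + g) / 2 * η))) := by
    intro η hη
    have hη : 0 < η := hη
    have hfactor (α : ℝ) (β : Fin q → ℝ) :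
        (2 * Real.pi) ^ (-((n : ℝ) + q) / 2) * (Xᵀ * X).det ^ ((1 : ℝ) / 2)
          * η ^ (((n : ℝ) + q) / 2 - 1) * g ^ (-((q - ν) / 2) - 1)
          * Real.exp (-(η / 2) * (∑ i, (y i - α - (X *ᵥ β) i) ^ 2
            + (β ⬝ᵥ (Xᵀ * X) *ᵥ β) / g))
        = ((2 * Real.pi) ^ (-((n : ℝ) + q) / 2) * (Xᵀ * X).det ^ ((1 : ℝ) / 2)
          * η ^ (((n : ℝ) + q) / 2 - 1) * g ^ (-((q - ν) / 2) - 1)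
          * Real.exp (-(S * (g * (1 - R) + 1) / (1 + g) / 2 * η)))
          * (Real.exp (-(η * n / 2) * (α - (∑ j, y j) / n) ^ 2)
            * Real.exp (-(η * ((1 + g) / g) / 2) * ((β - (g / (1 + g)) • b) ⬝ᵥ
              (Xᵀ * X) *ᵥ (β - (g / (1 + g)) • b)))) := by
      rw [sum_sq_residual_add_penalty hn0 hunit horth y α β hg hv hb, hP, ← hSdef, hs,
        ← Real.exp_add, mul_assoc _ (Real.exp _) (Real.exp _), ← Real.exp_add]
      congr 2
      ring
    simp_rw [hfactor]
    rw [lintegral_lintegral_exp_neg_quadratic hA (by positivity) (by positivity) _ _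
      (by positivity), ← ENNReal.ofReal_mul (by positivity), Fintype.card_fin]
    congr 1
    refine Real.log_injOn_pos (Set.mem_Ioi.2 (by positivity)) (Set.mem_Ioi.2 (by positivity)) ?_
    simp (disch := positivity) only [Real.log_mul, Real.log_div, Real.log_rpow, Real.log_exp]
    ring
  have hΓ := Real.Gamma_pos_of_pos (show 0 < ((n : ℝ) - 1) / 2 by linarith)
  rw [setLIntegral_congr_fun measurableSet_Ioi hinner,
    lintegral_const_mul' _ _ ENNReal.ofReal_ne_top,
    lintegral_rpow_mul_exp_neg_mul_Ioi (by linarith) (by positivity),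
    ← ENNReal.ofReal_mul (by positivity), ← ENNReal.ofReal_mul (by positivity)]
  congr 1
  refine Real.log_injOn_pos (Set.mem_Ioi.2 (by positivity)) (Set.mem_Ioi.2 (by positivity)) ?_
  simp (disch := positivity) only [Real.log_mul, Real.log_div, Real.log_rpow]
  ring
end

section
/- (Theorem 2, distributional robustness of BIC.) Let f : (0,∞) → [0,∞) be nonincreasing with 0 < A := sup_{t>0} t^{n/2} f(t) < ∞. Under the regression setup with design matrix X (n×q) and response y, sup over α ∈ ℝ, β ∈ ℝ^q and η > 0 of η^{n/2} f(η‖y − α1_n − Xβ‖²) equals A · (‖y − ȳ1_n‖² (1 − R²))^{−n/2}, where R² is the coefficient of determination of the model with design X. Consequently, if X_F is an n×p design of rank p (columns orthogonal to 1_n) and X_γ is an n×q_γ submatrix of its columns, and S_γ, S_F denote the corresponding suprema, then the BIC Bayes factor (S_γ n^{−q_γ/2}) / (S_F n^{−p/2}) equals [(1 − R_γ²)^{−n} n^{−q_γ} / ((1 − R_F²)^{−n} n^{−p})]^{1/2}, independently of f. -/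
open MeasureTheory Matrix

/-- The supremum over `α`, `β` and `η > 0` of the likelihood
`η^{n/2} f(η‖y-α1-Xβ‖²)`, entering the definition of BIC. -/
noncomputable def bicSup (n : ℕ) {ι : Type} [Fintype ι] [DecidableEq ι]
    (f : ℝ → ℝ) (X : Matrix (Fin n) ι ℝ) (y : Fin n → ℝ) : ℝ :=
  sSup {v | ∃ (α : ℝ) (β : ι → ℝ) (η : ℝ), 0 < η ∧
    v = η ^ ((n : ℝ) / 2) * f (η * ∑ i, (y i - α - X.mulVec β i) ^ 2)}
/-- A matrix of full column rank acts injectively. -/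
lemma mulVec_injective_of_rank_eq {n p : ℕ} {X : Matrix (Fin n) (Fin p) ℝ} (h : X.rank = p) :
    Function.Injective X.mulVec := by
  rw [Matrix.mulVec_injective_iff, linearIndependent_iff_card_eq_finrank_span, Fintype.card_fin,
    Set.finrank, ← Matrix.rank_eq_finrank_span_cols, h]

/-- A submatrix of columns acts as the whole matrix on vectors extended by zero. -/
lemma mulVec_columns {n p : ℕ} (X : Matrix (Fin n) (Fin p) ℝ) (γ : Finset (Fin p))
    (β : {j // j ∈ γ} → ℝ) :
    (Matrix.of fun i (j : {j // j ∈ γ}) => X i (j : Fin p)).mulVec β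
      = X.mulVec (fun j => if h : j ∈ γ then β ⟨j, h⟩ else 0) := by
  ext i
  simp only [Matrix.mulVec, dotProduct, Matrix.of_apply]
  rw [← Finset.sum_subset (Finset.subset_univ γ) (by intro j _ hj; simp [hj]),
    ← Finset.sum_coe_sort γ]
  exact Finset.sum_congr rfl fun j _ => by simp

/-- The supremum over the scale of a nonincreasing kernel evaluated at sums of squares bounded
below by an attained positive value. -/
lemma bicSup_eq_of_minimizer {n : ℕ} {ι : Type} [Fintype ι] [DecidableEq ι] {f : ℝ → ℝ}
    (hmono : AntitoneOn f (Set.Ioi 0))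
    (hbdd : BddAbove ((fun t => t ^ ((n : ℝ) / 2) * f t) '' Set.Ioi 0))
    (X : Matrix (Fin n) ι ℝ) (y : Fin n → ℝ) {r : ℝ} (hr : 0 < r)
    (hle : ∀ α β, r ≤ ∑ i, (y i - α - X.mulVec β i) ^ 2)
    (hex : ∃ α β, ∑ i, (y i - α - X.mulVec β i) ^ 2 = r) :
    bicSup n f X y
      = sSup ((fun t => t ^ ((n : ℝ) / 2) * f t) '' Set.Ioi 0) * r ^ (-(n : ℝ) / 2) := by
  obtain ⟨α₀, β₀, h₀⟩ := hex
  have hrp : 0 < r ^ ((n : ℝ) / 2) := Real.rpow_pos_of_pos hr _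
  have hub : ∀ v ∈ {v | ∃ (α : ℝ) (β : ι → ℝ) (η : ℝ), 0 < η ∧
      v = η ^ ((n : ℝ) / 2) * f (η * ∑ i, (y i - α - X.mulVec β i) ^ 2)},
      v ≤ sSup ((fun t => t ^ ((n : ℝ) / 2) * f t) '' Set.Ioi 0) / r ^ ((n : ℝ) / 2) := by
    rintro v ⟨α, β, η, hη, rfl⟩
    have hηr : 0 < η * r := mul_pos hη hr
    have hs := mul_le_mul_of_nonneg_left (hle α β) hη.le
    have h1 := hmono (Set.mem_Ioi.2 hηr) (Set.mem_Ioi.2 (hηr.trans_le hs)) hs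
    have h2 := le_csSup hbdd (Set.mem_image_of_mem _ (Set.mem_Ioi.2 hηr))
    rw [le_div_iff₀ hrp]
    refine le_trans ?_ h2
    simp only [Real.mul_rpow hη.le hr.le]
    have h3 := mul_le_mul_of_nonneg_left h1
      (mul_pos (Real.rpow_pos_of_pos hη ((n : ℝ) / 2)) hrp).le
    linarith
  rw [neg_div, Real.rpow_neg hr.le, ← div_eq_mul_inv]
  refine le_antisymm (csSup_le ⟨_, 0, 0, 1, one_pos, rfl⟩ hub) ?_
  rw [div_le_iff₀ hrp]
  refine csSup_le ((Set.nonempty_Ioi).image _) ?_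
  rintro _ ⟨t, ht, rfl⟩
  have ht : 0 < t := ht
  have h1 : (t / r) ^ ((n : ℝ) / 2) * f t ≤ bicSup n f X y := by
    refine le_csSup ⟨_, hub⟩ ⟨α₀, β₀, t / r, div_pos ht hr, ?_⟩
    rw [h₀, div_mul_cancel₀ _ hr.ne']
  rw [Real.div_rpow ht.le hr.le, div_mul_eq_mul_div, div_le_iff₀ hrp] at h1
  exact h1

/-- Least squares: the residual sum of squares `‖y-ȳ1‖²(1-R²)` is positive and is the attained
minimum of `‖y-α1-Xβ‖²`. -/
lemma residual_sum_of_squares {n : ℕ} {ι : Type} [Fintype ι] [DecidableEq ι] (hn : n ≠ 0)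
    (X : Matrix (Fin n) ι ℝ) (y : Fin n → ℝ) (hX : Function.Injective X.mulVec)
    (hone : Xᵀ.mulVec (fun _ => 1) = 0)
    (hz : (fun i => y i - (∑ j, y j) / n) ≠ 0)
    (hcol : ∀ β, (fun i => y i - (∑ j, y j) / n) ≠ X.mulVec β) :
    0 < (∑ i, (y i - (∑ j, y j) / n) ^ 2) ∧ 0 < 1 - coeffDet n X y ∧
    (∀ α β, (∑ i, (y i - (∑ j, y j) / n) ^ 2) * (1 - coeffDet n X y)
      ≤ ∑ i, (y i - α - X.mulVec β i) ^ 2) ∧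
    ∃ α β, ∑ i, (y i - α - X.mulVec β i) ^ 2
      = (∑ i, (y i - (∑ j, y j) / n) ^ 2) * (1 - coeffDet n X y) := by
  have sq_dot : ∀ v : Fin n → ℝ, ∑ i, v i ^ 2 = v ⬝ᵥ v := fun v => by
    simp [dotProduct, pow_two]
  have hpos : ∀ v : Fin n → ℝ, v ≠ 0 → 0 < v ⬝ᵥ v := fun v hv =>
    lt_of_le_of_ne (by rw [← sq_dot]; positivity) (Ne.symm (by simpa using hv))
  set m := (∑ j, y j) / n with hm
  set z : Fin n → ℝ := fun i => y i - m with hzdef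
  set b := (Xᵀ * X)⁻¹.mulVec (Xᵀ.mulVec z) with hb
  set r := z - X.mulVec b with hrdef
  have hdet : IsUnit (Xᵀ * X).det := by
    have h := (Matrix.PosDef.conjTranspose_mul_self X hX).isUnit
    rw [Matrix.conjTranspose_eq_transpose_of_trivial] at h
    exact (Matrix.isUnit_iff_isUnit_det _).1 h
  have hnormal : Xᵀ.mulVec r = 0 := by
    rw [hrdef, Matrix.mulVec_sub, hb, Matrix.mulVec_mulVec, Matrix.mulVec_mulVec,
      Matrix.mul_nonsing_inv _ hdet, Matrix.one_mulVec, sub_self]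
  have hperp : ∀ β, r ⬝ᵥ X.mulVec β = 0 := fun β => by
    rw [Matrix.dotProduct_mulVec, ← Matrix.mulVec_transpose, hnormal, zero_dotProduct]
  have hperp1 : ∀ β, (fun _ : Fin n => (1 : ℝ)) ⬝ᵥ X.mulVec β = 0 := fun β => by
    rw [Matrix.dotProduct_mulVec, ← Matrix.mulVec_transpose, hone, zero_dotProduct]
  have hr1 : r ⬝ᵥ (fun _ : Fin n => (1 : ℝ)) = 0 := by
    rw [hrdef, sub_dotProduct, dotProduct_comm (X.mulVec b), hperp1, sub_zero]
    have : (n : ℝ) ≠ 0 := Nat.cast_ne_zero.2 hn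
    simp only [dotProduct, hzdef, mul_one, Finset.sum_sub_distrib, Finset.sum_const,
      Finset.card_univ, Fintype.card_fin, nsmul_eq_mul, hm]
    field_simp
    simp
  have hrpos : 0 < r ⬝ᵥ r := hpos r (sub_ne_zero.2 (hcol b))
  have hzpos : 0 < z ⬝ᵥ z := hpos z hz
  have hzz : ∑ i, (y i - m) ^ 2 = z ⬝ᵥ z := sq_dot z
  have hR : coeffDet n X y = (X.mulVec b ⬝ᵥ X.mulVec b) / (z ⬝ᵥ z) := by
    rw [← sq_dot, ← sq_dot]
    rfl
  have hpyth : z ⬝ᵥ z = r ⬝ᵥ r + X.mulVec b ⬝ᵥ X.mulVec b := by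
    have : z = r + X.mulVec b := by simp [hrdef]
    rw [this, add_dotProduct, dotProduct_add, dotProduct_add, dotProduct_comm (X.mulVec b) r,
      hperp]
    ring
  have hrss : z ⬝ᵥ z * (1 - coeffDet n X y) = r ⬝ᵥ r := by
    rw [hR, mul_sub, mul_div_cancel₀ _ hzpos.ne']
    linarith
  rw [hzz, hrss]
  refine ⟨hzpos, ?_, fun α β => ?_, m, b, sq_dot r⟩
  · exact (mul_pos_iff_of_pos_left hzpos).1 (hrss ▸ hrpos)
  · set d : Fin n → ℝ := (m - α) • (fun _ => (1 : ℝ)) + X.mulVec (b - β) with hd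
    have h1 : ∑ i, (y i - α - X.mulVec β i) ^ 2 = (r + d) ⬝ᵥ (r + d) := by
      rw [← sq_dot]
      refine Finset.sum_congr rfl fun i _ => ?_
      simp only [hd, hrdef, hzdef, Matrix.mulVec_sub, Pi.add_apply, Pi.sub_apply, Pi.smul_apply,
        smul_eq_mul]
      ring
    have h2 : r ⬝ᵥ d = 0 := by
      rw [hd, dotProduct_add, dotProduct_smul, hr1, hperp, smul_zero, add_zero]
    have h3 : 0 ≤ d ⬝ᵥ d := by rw [← sq_dot]; positivity
    rw [h1, add_dotProduct, dotProduct_add r, dotProduct_add d, dotProduct_comm d r, h2]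
    linarith

/-- **Theorem 2, distributional robustness of BIC.** For a nonincreasing
spherically symmetric error kernel `f` with `A = sup_{t>0} t^{n/2} f(t) ∈ (0,∞)`, the
maximized likelihood equals `A · (RSS)^{-n/2}`, and consequently the BIC-based Bayes
factor of a submodel against the full model is independent of `f`. -/
theorem bic_robust
    (n : ℕ) (f : ℝ → ℝ)
    (hmono : AntitoneOn f (Set.Ioi 0)) (hpos : ∀ t, 0 ≤ f t)
    (hbdd : BddAbove ((fun t => t ^ ((n : ℝ) / 2) * f t) '' Set.Ioi 0))
    (hA : 0 < sSup ((fun t => t ^ ((n : ℝ) / 2) * f t) '' Set.Ioi 0)) :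
    (∀ (q : ℕ) (X : Matrix (Fin n) (Fin q) ℝ) (y : Fin n → ℝ),
      q + 1 < n → X.rank = q → Xᵀ.mulVec (fun _ => 1) = 0 →
      (fun i => y i - (∑ j, y j) / n) ≠ 0 →
      (∀ β : Fin q → ℝ, (fun i => y i - (∑ j, y j) / n) ≠ X.mulVec β) →
      bicSup n f X y
        = sSup ((fun t => t ^ ((n : ℝ) / 2) * f t) '' Set.Ioi 0)
            * ((∑ i, (y i - (∑ j, y j) / n) ^ 2) * (1 - coeffDet n X y))
                ^ (-(n : ℝ) / 2)) ∧
    (∀ (p : ℕ) (XF : Matrix (Fin n) (Fin p) ℝ) (γ : Finset (Fin p)) (y : Fin n → ℝ),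
      p + 1 < n → XF.rank = p → XFᵀ.mulVec (fun _ => 1) = 0 → γ.Nonempty →
      (fun i => y i - (∑ j, y j) / n) ≠ 0 →
      (∀ β : Fin p → ℝ, (fun i => y i - (∑ j, y j) / n) ≠ XF.mulVec β) →
      (bicSup n f (Matrix.of fun i (j : {j // j ∈ γ}) => XF i (j : Fin p)) y
          * (n : ℝ) ^ (-(γ.card : ℝ) / 2))
        / (bicSup n f XF y * (n : ℝ) ^ (-(p : ℝ) / 2))
      = ((1 - coeffDet n (Matrix.of fun i (j : {j // j ∈ γ}) => XF i (j : Fin p)) y)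
            ^ (-(n : ℝ)) * (n : ℝ) ^ (-(γ.card : ℝ))
          / ((1 - coeffDet n XF y) ^ (-(n : ℝ)) * (n : ℝ) ^ (-(p : ℝ))))
        ^ ((1:ℝ) / 2)) := by
  have key : ∀ {ι : Type} [Fintype ι] [DecidableEq ι] (X : Matrix (Fin n) ι ℝ) (y : Fin n → ℝ),
      n ≠ 0 → Function.Injective X.mulVec → Xᵀ.mulVec (fun _ => 1) = 0 →
      (fun i => y i - (∑ j, y j) / n) ≠ 0 →
      (∀ β, (fun i => y i - (∑ j, y j) / n) ≠ X.mulVec β) →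
      bicSup n f X y = sSup ((fun t => t ^ ((n : ℝ) / 2) * f t) '' Set.Ioi 0)
        * ((∑ i, (y i - (∑ j, y j) / n) ^ 2) * (1 - coeffDet n X y)) ^ (-(n : ℝ) / 2) := by
    intro ι _ _ X y hn hX hone hz hcol
    obtain ⟨h1, h2, h3, h4⟩ := residual_sum_of_squares hn X y hX hone hz hcol
    exact bicSup_eq_of_minimizer hmono hbdd X y (mul_pos h1 h2) h3 h4
  refine ⟨fun q X y hq hrank hone hz hcol =>
    key X y (by omega) (mulVec_injective_of_rank_eq hrank) hone hz hcol, ?_⟩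
  intro p XF γ y hp hrank hone _ hz hcol
  have hn : n ≠ 0 := by omega
  have hinj := mulVec_injective_of_rank_eq hrank
  set Xγ : Matrix (Fin n) {j // j ∈ γ} ℝ := Matrix.of fun i (j : {j // j ∈ γ}) => XF i (j : Fin p)
    with hXγ
  have hinjγ : Function.Injective Xγ.mulVec := by
    intro β β' h
    simp only [hXγ, mulVec_columns] at h
    ext ⟨j, hj⟩
    simpa [hj] using congrFun (hinj h) j
  have honeγ : Xγᵀ.mulVec (fun _ => 1) = 0 := by
    ext j
    exact congrFun hone (j : Fin p)
  have hcolγ : ∀ β, (fun i => y i - (∑ j, y j) / n) ≠ Xγ.mulVec β := fun β => by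
    rw [hXγ, mulVec_columns]
    exact hcol _
  obtain ⟨hT, hF, -, -⟩ := residual_sum_of_squares hn XF y hinj hone hz hcol
  obtain ⟨-, hγ, -, -⟩ := residual_sum_of_squares hn Xγ y hinjγ honeγ hz hcolγ
  rw [key XF y hn hinj hone hz hcol, key Xγ y hn hinjγ honeγ hz hcolγ]
  have hn0 : (0 : ℝ) < n := by positivity
  have half : ∀ x a b : ℝ, 0 < x →
      (x ^ (-a) * (n : ℝ) ^ (-b)) ^ ((1 : ℝ) / 2) = x ^ (-a / 2) * (n : ℝ) ^ (-b / 2) :=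
    fun x a b hx => by
      rw [Real.mul_rpow (by positivity) (by positivity), ← Real.rpow_mul hx.le,
        ← Real.rpow_mul hn0.le, mul_one_div, mul_one_div]
  rw [Real.div_rpow (by positivity) (by positivity), half _ _ _ hγ, half _ _ _ hF,
    Real.mul_rpow hT.le hγ.le, Real.mul_rpow hT.le hF.le,
    ← mul_assoc, ← mul_assoc, mul_assoc (_ * _), mul_assoc (_ * _)]
  exact mul_div_mul_left _ _ (mul_pos hA (Real.rpow_pos_of_pos hT _)).ne'
end

section
/- (Laplace mode asymptotics.) Fix real numbers k ≥ 0, q > 0, ν with −k < ν < q, and r with 0 < r < 1. For each integer n ≥ 2, the equation (n−1)(1−r)/(1 + r z) + (ν+k)/z − (q−ν) = 0 has exactly one root z = ẑ_n in (0,∞), and lim_{n→∞} ẑ_n / n = (1/r − 1)/(q − ν). -/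
open Filter

/-- The left-hand side of the first-order condition is strictly decreasing on `(0, ∞)`. -/
lemma strictAntiOn_firstOrder {a b c r : ℝ} (ha : 0 < a) (hc : 0 < c) (hr : 0 < r) :
    StrictAntiOn (fun z : ℝ => c / (1 + r * z) + a / z - b) (Set.Ioi 0) := by
  intro z (hz : 0 < z) w _ hzw
  have h₁ : c / (1 + r * w) < c / (1 + r * z) := by gcongr
  have h₂ : a / w < a / z := by gcongr
  dsimp only
  linarith

/-- The first-order condition has a positive root, the larger root of a quadratic. -/
lemma exists_pos_root_firstOrder {a b c r : ℝ} (ha : 0 < a) (hb : 0 < b) (hr : 0 < r) :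
    ∃ z : ℝ, 0 < z ∧ c / (1 + r * z) + a / z - b = 0 := by
  obtain ⟨B, hB⟩ : ∃ B, B = b - c - a * r := ⟨_, rfl⟩
  have hpos : 0 < 4 * (b * r * a) := by positivity
  have hsq : √(B ^ 2 + 4 * (b * r * a)) ^ 2 = B ^ 2 + 4 * (b * r * a) :=
    Real.sq_sqrt (by positivity)
  have hlt : B < √(B ^ 2 + 4 * (b * r * a)) := Real.lt_sqrt_of_sq_lt (by linarith)
  generalize √(B ^ 2 + 4 * (b * r * a)) = s at hsq hlt
  obtain ⟨z, hz⟩ : ∃ z, z = (s - B) / (2 * (b * r)) := ⟨_, rfl⟩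
  have hz₀ : 0 < z := hz ▸ div_pos (by linarith) (by positivity)
  have hs : s = 2 * (b * r) * z + B := by
    rw [hz]
    field_simp
    ring
  have hquad : b * r * z ^ 2 + B * z - a = 0 := by
    have : 4 * (b * r) * (b * r * z ^ 2 + B * z - a) = 0 := by
      rw [hs] at hsq
      linear_combination hsq
    exact (mul_eq_zero.mp this).resolve_left (by positivity)
  have h₁ : 1 + r * z ≠ 0 := by positivity
  refine ⟨z, hz₀, ?_⟩
  field_simp
  rw [hB] at hquad
  linear_combination -hquad

/-- Two-sided bounds on a positive root of the first-order condition. -/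
lemma root_firstOrder_mem_Icc {a b c r z : ℝ} (ha : 0 < a) (hb : 0 < b) (hc : 0 < c) (hr : 0 < r)
    (hz : 0 < z) (h : c / (1 + r * z) + a / z - b = 0) :
    z ∈ Set.Icc (c / (r * b) - 1 / r) (c / (r * b) + a / b) := by
  have hd : 0 < 1 + r * z := by positivity
  constructor
  · have h₁ : c / (1 + r * z) ≤ b := by
      have : 0 < a / z := by positivity
      linarith
    rw [div_le_iff₀ hd] at h₁
    have h₂ : c / (r * b) ≤ 1 / r + z := by
      rw [div_le_iff₀ (by positivity)]
      field_simp
      linarith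
    linarith
  · have h₁ : c / (1 + r * z) ≤ c / (r * z) := by
      gcongr
      linarith
    have h₂ : b * z ≤ (c / (r * z) + a / z) * z := by
      gcongr
      linarith
    have h₃ : (c / (r * z) + a / z) * z = (c / (r * b) + a / b) * b := by
      field_simp
    rw [h₃, mul_comm b z] at h₂
    exact le_of_mul_le_mul_right h₂ hb

/-- **Laplace mode asymptotics.** For each `n ≥ 2` the first-order
condition `(n-1)(1-r)/(1+rz) + (ν+k)/z - (q-ν) = 0` has exactly one root
`ẑ_n ∈ (0,∞)`, and `ẑ_n/n → (1/r-1)/(q-ν)` as `n → ∞`. -/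
theorem laplace_mode_asymptotics
    (k q ν r : ℝ) (hk : 0 ≤ k) (hq : 0 < q) (hν₁ : -k < ν) (hν₂ : ν < q)
    (hr₀ : 0 < r) (hr₁ : r < 1) :
    ∃ zhat : ℕ → ℝ,
      (∀ n : ℕ, 2 ≤ n →
        0 < zhat n ∧
        ((n : ℝ) - 1) * (1 - r) / (1 + r * zhat n) + (ν + k) / zhat n - (q - ν) = 0 ∧
        ∀ z : ℝ, 0 < z →
          ((n : ℝ) - 1) * (1 - r) / (1 + r * z) + (ν + k) / z - (q - ν) = 0 →
          z = zhat n) ∧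
      Tendsto (fun n : ℕ => zhat n / (n : ℝ)) atTop (nhds ((1 / r - 1) / (q - ν))) := by
  have ha : 0 < ν + k := by linarith
  have hb : 0 < q - ν := by linarith
  have hc (n : ℕ) (hn : 2 ≤ n) : 0 < ((n : ℝ) - 1) * (1 - r) := by
    have : (2 : ℝ) ≤ n := by exact_mod_cast hn
    exact mul_pos (by linarith) (by linarith)
  choose zhat hpos hroot using fun n : ℕ =>
    exists_pos_root_firstOrder (c := ((n : ℝ) - 1) * (1 - r)) ha hb hr₀
  refine ⟨zhat, fun n hn => ⟨hpos n, hroot n, fun z hz hz_root => ?_⟩, ?_⟩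
  · exact (strictAntiOn_firstOrder ha (hc n hn) hr₀).injOn hz (hpos n)
      (hz_root.trans (hroot n).symm)
  · obtain ⟨L, hL⟩ : ∃ L, L = (1 / r - 1) / (q - ν) := ⟨_, rfl⟩
    have hlead (n : ℕ) : ((n : ℝ) - 1) * (1 - r) / (r * (q - ν)) = n * L - L := by
      rw [hL]
      field_simp
    have hlim (C : ℝ) : Tendsto (fun n : ℕ => L + C / (n : ℝ)) atTop (nhds L) := by
      simpa using (tendsto_const_div_atTop_nhds_zero_nat C).const_add L
    rw [← hL]
    refine tendsto_of_tendsto_of_tendsto_of_le_of_le'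
      (hlim (-L - 1 / r)) (hlim (-L + (ν + k) / (q - ν))) ?_ ?_
    all_goals
      filter_upwards [eventually_ge_atTop 2] with n hn
      have hn₀ : (0 : ℝ) < n := by exact_mod_cast (by lia : 0 < n)
      obtain ⟨hl, hu⟩ := root_firstOrder_mem_Icc ha hb (hc n hn) hr₀ (hpos n) (hroot n)
      rw [hlead] at hl hu
    · rw [le_div_iff₀ hn₀, add_mul, div_mul_cancel₀ _ hn₀.ne']
      linarith
    · rw [div_le_iff₀ hn₀, add_mul, div_mul_cancel₀ _ hn₀.ne']
      linarith
end

section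
/- (Tauberian tail of the mixture prior density.) Fix real numbers k ≥ 0, q > 0 and ν < q. For t > 0 define h(t) = ∫₀^∞ g^{ν/2−1} (1 + g^{−1})^{−k/2} (2πg)^{−q/2} exp(−t/(2g)) dg. Then h(t) is finite for every t > 0 and lim_{t→∞} t^{(q−ν)/2} h(t) = Γ((q−ν)/2) / (2^{ν/2} π^{q/2}). In particular, the scale mixture of Gaussian priors with mixing weight g^{ν/2−1}(1+g^{−1})^{−k/2} has, up to this constant, tail of order t^{−(q−ν)/2}, the same order for every k ≥ 0. -/
open Filter MeasureTheory

/-- The unnormalised inverse-gamma density is integrable on `(0, ∞)`. -/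
theorem integrableOn_rpow_mul_exp_neg_mul_inv {a r : ℝ} (ha : 0 < a) (hr : 0 < r) :
    IntegrableOn (fun x : ℝ => x ^ (-a - 1) * Real.exp (-(r * x⁻¹))) (Set.Ioi 0) := by
  have hg : IntegrableOn (fun x : ℝ => x ^ (a - 1) * Real.exp (-r * x ^ (1 : ℝ))) (Set.Ioi 0) :=
    integrableOn_rpow_mul_exp_neg_mul_rpow (by linarith) one_pos hr
  refine ((integrableOn_Ioi_comp_rpow_iff' _ (neg_ne_zero.mpr one_ne_zero)).mpr hg).congr_fun
    (fun x (hx : 0 < x) => ?_) measurableSet_Ioi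
  simp only [smul_eq_mul, Real.rpow_one]
  rw [← mul_assoc, ← Real.rpow_mul hx.le, ← Real.rpow_add hx, Real.rpow_neg_one, neg_mul]
  ring_nf

/-- The total mass of the unnormalised inverse-gamma density. -/
theorem integral_rpow_mul_exp_neg_mul_inv {a r : ℝ} (ha : 0 < a) (hr : 0 < r) :
    ∫ x in Set.Ioi (0 : ℝ), x ^ (-a - 1) * Real.exp (-(r * x⁻¹)) =
      (1 / r) ^ a * Real.Gamma a := by
  rw [← Real.integral_rpow_mul_exp_neg_mul_Ioi ha hr,
    ← integral_comp_rpow_Ioi _ (neg_ne_zero.mpr one_ne_zero)]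
  refine setIntegral_congr_fun measurableSet_Ioi fun x (hx : 0 < x) => ?_
  simp only [smul_eq_mul, abs_neg, abs_one, one_mul]
  rw [← mul_assoc, ← Real.rpow_mul hx.le, ← Real.rpow_add hx, Real.rpow_neg_one, inv_inv]
  ring_nf

theorem one_add_inv_rpow_mem_Icc {k x : ℝ} (hk : 0 ≤ k) (hx : 0 < x) :
    (1 + x⁻¹) ^ (-k / 2) ∈ Set.Icc (0 : ℝ) 1 := by
  have hx' : 0 < x⁻¹ := inv_pos.mpr hx
  exact ⟨by positivity, Real.rpow_le_one_of_one_le_of_nonpos (by linarith) (by linarith)⟩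

theorem mixture_integrand_eq (k q ν : ℝ) {t g : ℝ} (hg : 0 < g) :
    g ^ (ν / 2 - 1) * (1 + g⁻¹) ^ (-k / 2) * (2 * Real.pi * g) ^ (-q / 2)
        * Real.exp (-t / (2 * g)) =
      (2 * Real.pi) ^ (-q / 2) * ((1 + g⁻¹) ^ (-k / 2) *
        (g ^ (-((q - ν) / 2) - 1) * Real.exp (-(t / 2 * g⁻¹)))) := by
  have hexp : -t / (2 * g) = -(t / 2 * g⁻¹) := by field_simp
  have hpow : -((q - ν) / 2) - 1 = (ν / 2 - 1) + -q / 2 := by ring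
  rw [Real.mul_rpow Real.two_pi_pos.le hg.le, hexp, hpow, Real.rpow_add hg]
  ring

theorem rpow_mul_integral_mixture (k : ℝ) {a t : ℝ} (ht : 0 < t) :
    t ^ a * ∫ g in Set.Ioi (0 : ℝ), (1 + g⁻¹) ^ (-k / 2) *
        (g ^ (-a - 1) * Real.exp (-(t / 2 * g⁻¹))) =
      ∫ s in Set.Ioi (0 : ℝ), (1 + (t * s)⁻¹) ^ (-k / 2) *
        (s ^ (-a - 1) * Real.exp (-(1 / 2 * s⁻¹))) := by
  have hscale := integral_comp_mul_left_Ioi (fun g : ℝ => (1 + g⁻¹) ^ (-k / 2) *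
        (g ^ (-a - 1) * Real.exp (-(t / 2 * g⁻¹)))) 0 ht
  rw [mul_zero, smul_eq_mul, eq_inv_mul_iff_mul_eq₀ ht.ne'] at hscale
  rw [← hscale, ← mul_assoc, ← integral_const_mul]
  refine setIntegral_congr_fun measurableSet_Ioi fun s (hs : 0 < s) => ?_
  have hexp : t / 2 * (t * s)⁻¹ = 1 / 2 * s⁻¹ := by field_simp
  have hpow : t ^ a * t * t ^ (-a - 1) = 1 := by
    nth_rewrite 2 [← Real.rpow_one t]
    rw [← Real.rpow_add ht, ← Real.rpow_add ht]
    simp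
  simp only [hexp]
  rw [Real.mul_rpow ht.le hs.le]
  linear_combination ((1 + (t * s)⁻¹) ^ (-k / 2) *
    (s ^ (-a - 1) * Real.exp (-(1 / 2 * s⁻¹)))) * hpow

theorem tendsto_integral_scaled_mixture {k a : ℝ} (hk : 0 ≤ k) (ha : 0 < a) :
    Tendsto (fun t : ℝ => ∫ s in Set.Ioi (0 : ℝ), (1 + (t * s)⁻¹) ^ (-k / 2) *
        (s ^ (-a - 1) * Real.exp (-(1 / 2 * s⁻¹))))
      atTop (nhds (2 ^ a * Real.Gamma a)) := by
  have hmass := integral_rpow_mul_exp_neg_mul_inv ha (one_half_pos (α := ℝ))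
  rw [one_div_one_div] at hmass
  rw [← hmass]
  refine tendsto_integral_filter_of_dominated_convergence _
    (Eventually.of_forall fun t => Measurable.aestronglyMeasurable (by fun_prop)) ?_
    (integrableOn_rpow_mul_exp_neg_mul_inv ha one_half_pos) ?_
  · filter_upwards [eventually_gt_atTop 0] with t ht
    filter_upwards [ae_restrict_mem measurableSet_Ioi] with s (hs : 0 < s)
    have hmem := one_add_inv_rpow_mem_Icc hk (mul_pos ht hs)
    have hnonneg : 0 ≤ s ^ (-a - 1) * Real.exp (-(1 / 2 * s⁻¹)) := by positivity
    rw [Real.norm_of_nonneg (mul_nonneg hmem.1 hnonneg)]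
    exact mul_le_of_le_one_left hnonneg hmem.2
  · filter_upwards [ae_restrict_mem measurableSet_Ioi] with s (hs : 0 < s)
    have hinv : Tendsto (fun t : ℝ => 1 + (t * s)⁻¹) atTop (nhds 1) := by
      simpa using (tendsto_inv_atTop_zero.comp (tendsto_id.atTop_mul_const hs)).const_add (1 : ℝ)
    simpa using (hinv.rpow_const (p := -k / 2) (Or.inl one_ne_zero)).mul_const
      (s ^ (-a - 1) * Real.exp (-(1 / 2 * s⁻¹)))

/-- **Tauberian tail of the mixture prior density.** The mixture density
`h(t) = ∫₀^∞ g^{ν/2-1}(1+g⁻¹)^{-k/2}(2πg)^{-q/2} exp(-t/(2g)) dg` is finite for every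
`t > 0` and satisfies `t^{(q-ν)/2} h(t) → Γ((q-ν)/2)/(2^{ν/2}π^{q/2})` as `t → ∞`. -/
theorem mixture_prior_tauberian_tail
    (k q ν : ℝ) (hk : 0 ≤ k) (hq : 0 < q) (hν : ν < q) :
    (∀ t : ℝ, 0 < t → IntegrableOn
      (fun g : ℝ => g ^ (ν / 2 - 1) * (1 + g⁻¹) ^ (-k / 2)
        * (2 * Real.pi * g) ^ (-q / 2) * Real.exp (-t / (2 * g))) (Set.Ioi 0)) ∧
    Tendsto (fun t : ℝ => t ^ ((q - ν) / 2) *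
        ∫ g in Set.Ioi (0:ℝ), g ^ (ν / 2 - 1) * (1 + g⁻¹) ^ (-k / 2)
          * (2 * Real.pi * g) ^ (-q / 2) * Real.exp (-t / (2 * g)))
      atTop (nhds (Real.Gamma ((q - ν) / 2) / (2 ^ (ν / 2) * Real.pi ^ (q / 2)))) := by
  have ha : 0 < (q - ν) / 2 := by linarith
  refine ⟨fun t ht => ?_, ?_⟩
  · refine (((integrableOn_rpow_mul_exp_neg_mul_inv ha (half_pos ht)).bdd_mul (c := 1)
      (f := fun g : ℝ => (1 + g⁻¹) ^ (-k / 2))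
      (Measurable.aestronglyMeasurable (by fun_prop)) ?_).const_mul
      ((2 * Real.pi) ^ (-q / 2))).congr ?_
    · filter_upwards [ae_restrict_mem measurableSet_Ioi] with g (hg : 0 < g)
      have hmem := one_add_inv_rpow_mem_Icc hk hg
      rw [Real.norm_of_nonneg hmem.1]
      exact hmem.2
    · filter_upwards [ae_restrict_mem measurableSet_Ioi] with g (hg : 0 < g)
      exact (mixture_integrand_eq k q ν hg).symm
  · have hconst : Real.Gamma ((q - ν) / 2) / (2 ^ (ν / 2) * Real.pi ^ (q / 2)) =
        (2 * Real.pi) ^ (-q / 2) * (2 ^ ((q - ν) / 2) * Real.Gamma ((q - ν) / 2)) := by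
      rw [neg_div, Real.rpow_neg Real.two_pi_pos.le, Real.mul_rpow two_pos.le Real.pi_pos.le,
        sub_div, Real.rpow_sub two_pos]
      field_simp
    rw [hconst]
    refine ((tendsto_integral_scaled_mixture hk ha).const_mul _).congr' ?_
    filter_upwards [eventually_gt_atTop 0] with t ht
    rw [← rpow_mul_integral_mixture k ht, mul_left_comm, ← integral_const_mul]
    congr 1
    exact setIntegral_congr_fun measurableSet_Ioi fun g hg =>
      (mixture_integrand_eq k q ν hg).symm
end

section
/- (Lemma 3, part 1.) Under the consistency setup, let T be nonempty and let γ ⊆ {1,…,p} be nonempty, and assume additionally that liminf_{n→∞} n^{−1} ‖(I_n − Q_γ) X_T^{(n)} β_T‖² > 0 (this holds automatically whenever T ⊆ γ). Then for every k with 0 < k < 1 there exists a constant c > 2, not depending on n, such that for all sufficiently large n, 𝒫( 1/c < R_γ² < 1 − 1/c ) > 1 − k. -/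
open MeasureTheory Matrix Filter ENNReal

/-- The submatrix of `X` consisting of the columns indexed by `γ`. -/
noncomputable def designSub {n p : ℕ} (X : Matrix (Fin n) (Fin p) ℝ)
    (γ : Finset (Fin p)) : Matrix (Fin n) {j // j ∈ γ} ℝ :=
  Matrix.of fun i j => X i (j : Fin p)

/-- The residual projector `Q_γ = I - X_γ(X_γᵀX_γ)⁻¹X_γᵀ` of the submodel `γ`. -/
noncomputable def residProj {n p : ℕ} (X : Matrix (Fin n) (Fin p) ℝ)
    (γ : Finset (Fin p)) : Matrix (Fin n) (Fin n) ℝ :=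
  1 - designSub X γ * ((designSub X γ)ᵀ * designSub X γ)⁻¹ * (designSub X γ)ᵀ

/-- The coefficient of determination
`R_γ² = 1 - ‖Q_γ(y-ȳ1)‖²/‖y-ȳ1‖²` of the submodel `γ`. -/
noncomputable def RsqC {n p : ℕ} (X : Matrix (Fin n) (Fin p) ℝ) (γ : Finset (Fin p))
    (y : Fin n → ℝ) : ℝ :=
  1 - (∑ i, ((residProj X γ).mulVec (fun j => y j - (∑ l, y l) / n) i) ^ 2)
      / (∑ i, (y i - (∑ l, y l) / n) ^ 2)

/-- The response `y = α_T 1 + X β_T + σ_T ε` of the true model. -/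
noncomputable def yResp {n p : ℕ} (X : Matrix (Fin n) (Fin p) ℝ) (αT : ℝ)
    (βT : Fin p → ℝ) (σT : ℝ) (ε : Fin n → ℝ) : Fin n → ℝ :=
  fun i => αT + X.mulVec βT i + σT * ε i

/-- The projection matrix `D(DᵀD)⁻¹Dᵀ` onto the column space of `D`. -/
noncomputable def hatMatrix {ι κ : Type*} [Fintype ι] [Fintype κ] [DecidableEq κ]
    (D : Matrix ι κ ℝ) : Matrix ι ι ℝ :=
  D * (Dᵀ * D)⁻¹ * Dᵀ

section HatMatrix

variable {ι κ : Type*} [Fintype ι] [Fintype κ] [DecidableEq κ] {D : Matrix ι κ ℝ}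

theorem hatMatrix_transpose : (hatMatrix D)ᵀ = hatMatrix D := by
  simp [hatMatrix, Matrix.transpose_mul, Matrix.transpose_nonsing_inv, Matrix.mul_assoc]

theorem hatMatrix_mul_self_right (h : IsUnit (Dᵀ * D).det) : hatMatrix D * D = D := by
  rw [hatMatrix, Matrix.mul_assoc, Matrix.mul_assoc, Matrix.nonsing_inv_mul _ h, Matrix.mul_one]

theorem hatMatrix_idem (h : IsUnit (Dᵀ * D).det) : hatMatrix D * hatMatrix D = hatMatrix D := by
  conv_lhs => rw [hatMatrix.eq_def (D := D)]
  rw [← hatMatrix, hatMatrix, ← Matrix.mul_assoc, ← Matrix.mul_assoc, ← hatMatrix,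
    hatMatrix_mul_self_right h, ← hatMatrix]

theorem trace_hatMatrix (h : IsUnit (Dᵀ * D).det) :
    (hatMatrix D).trace = Fintype.card κ := by
  rw [hatMatrix, Matrix.trace_mul_comm, ← Matrix.mul_assoc, Matrix.mul_nonsing_inv _ h,
    Matrix.trace_one]

theorem hatMatrix_mulVec_one (hD : ∀ j, ∑ i, D i j = 0) : hatMatrix D *ᵥ 1 = 0 := by
  have : Dᵀ *ᵥ (1 : ι → ℝ) = 0 := by
    ext j
    simpa [Matrix.mulVec, dotProduct] using hD j
  rw [hatMatrix, ← Matrix.mulVec_mulVec, this, Matrix.mulVec_zero]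

theorem dotProduct_self_real_nonneg (v : ι → ℝ) : 0 ≤ v ⬝ᵥ v :=
  Finset.sum_nonneg fun i _ => mul_self_nonneg (v i)

theorem dotProduct_self_add_le (u v : ι → ℝ) :
    (u + v) ⬝ᵥ (u + v) ≤ 2 * (u ⬝ᵥ u) + 2 * (v ⬝ᵥ v) := by
  have := dotProduct_self_real_nonneg (u - v)
  simp only [add_dotProduct, dotProduct_add, sub_dotProduct, dotProduct_sub] at *
  linarith

theorem dotProduct_self_le_add (u v : ι → ℝ) :
    u ⬝ᵥ u ≤ 2 * ((u + v) ⬝ᵥ (u + v)) + 2 * (v ⬝ᵥ v) := by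
  simpa using dotProduct_self_add_le (u + v) (-v)

variable [DecidableEq ι]

theorem dotProduct_self_eq_of_projection {A : Matrix ι ι ℝ} (hA : Aᵀ = A) (hA' : A * A = A)
    (v : ι → ℝ) :
    v ⬝ᵥ v = (A *ᵥ v) ⬝ᵥ (A *ᵥ v) + ((1 - A) *ᵥ v) ⬝ᵥ ((1 - A) *ᵥ v) := by
  have key : (A *ᵥ v) ⬝ᵥ (A *ᵥ v) = v ⬝ᵥ (A *ᵥ v) := by
    conv_rhs => rw [← hA', ← Matrix.mulVec_mulVec, Matrix.dotProduct_mulVec,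
      ← Matrix.mulVec_transpose, hA]
  have := dotProduct_comm v (A *ᵥ v)
  simp only [Matrix.sub_mulVec, Matrix.one_mulVec, sub_dotProduct, dotProduct_sub]
  linarith

end HatMatrix

theorem dotProduct_self_mulVec_eq_sum {ι κ : Type*} [Fintype ι] [Fintype κ]
    (A : Matrix ι κ ℝ) (v : κ → ℝ) :
    (A *ᵥ v) ⬝ᵥ (A *ᵥ v) = ∑ i, ∑ j, ∑ k, A i j * A i k * (v j * v k) := by
  simp only [dotProduct, Matrix.mulVec, Finset.sum_mul_sum]
  refine Finset.sum_congr rfl fun i _ => Finset.sum_congr rfl fun j _ =>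
    Finset.sum_congr rfl fun k _ => by ring

section SecondMoments

variable {Ω : Type*} [MeasurableSpace Ω] {P : Measure Ω} {ι κ : Type*} [DecidableEq κ]
  {ε : Ω → κ → ℝ}

theorem integrable_mul_of_second_moments (hmeas : Measurable ε)
    (hcov : ∀ i j, ∫ ω, ε ω i * ε ω j ∂P = if i = j then 1 else 0) (i j : κ) :
    Integrable (fun ω => ε ω i * ε ω j) P := by
  have hm : ∀ i, Measurable fun ω => ε ω i := fun i => (measurable_pi_apply i).comp hmeas
  have hL : ∀ i, MemLp (fun ω => ε ω i) 2 P := fun i => by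
    rw [memLp_two_iff_integrable_sq (hm i).aestronglyMeasurable]
    simp only [pow_two]
    refine Integrable.of_integral_ne_zero ?_
    rw [hcov]
    simp
  exact (hL i).integrable_mul (hL j)

variable [Fintype ι] [Fintype κ]

theorem integrable_dotProduct_self_mulVec (hmeas : Measurable ε)
    (hcov : ∀ i j, ∫ ω, ε ω i * ε ω j ∂P = if i = j then 1 else 0) (A : Matrix ι κ ℝ) :
    Integrable (fun ω => (A *ᵥ ε ω) ⬝ᵥ (A *ᵥ ε ω)) P := by
  simp only [dotProduct_self_mulVec_eq_sum]
  exact integrable_finsetSum _ fun i _ => integrable_finsetSum _ fun j _ =>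
    integrable_finsetSum _ fun k _ =>
      (integrable_mul_of_second_moments hmeas hcov j k).const_mul _

theorem integral_dotProduct_self_mulVec (hmeas : Measurable ε)
    (hcov : ∀ i j, ∫ ω, ε ω i * ε ω j ∂P = if i = j then 1 else 0) (A : Matrix ι κ ℝ) :
    ∫ ω, (A *ᵥ ε ω) ⬝ᵥ (A *ᵥ ε ω) ∂P = (A * Aᵀ).trace := by
  have hI := fun i j k =>
    (integrable_mul_of_second_moments hmeas hcov j k).const_mul (A i j * A i k)
  simp only [dotProduct_self_mulVec_eq_sum]
  rw [integral_finsetSum _ fun i _ => integrable_finsetSum _ fun j _ =>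
    integrable_finsetSum _ fun k _ => hI i j k]
  simp only [Matrix.trace, Matrix.diag, Matrix.mul_apply, Matrix.transpose_apply]
  refine Finset.sum_congr rfl fun i _ => ?_
  rw [integral_finsetSum _ fun j _ => integrable_finsetSum _ fun k _ => hI i j k]
  refine Finset.sum_congr rfl fun j _ => ?_
  rw [integral_finsetSum _ fun k _ => hI i j k]
  simp only [integral_const_mul, hcov]
  simp

theorem integral_dotProduct_self_hatMatrix [DecidableEq ι] (hmeas : Measurable ε)
    (hcov : ∀ i j, ∫ ω, ε ω i * ε ω j ∂P = if i = j then 1 else 0) {D : Matrix κ ι ℝ}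
    (h : IsUnit (Dᵀ * D).det) :
    ∫ ω, (hatMatrix D *ᵥ ε ω) ⬝ᵥ (hatMatrix D *ᵥ ε ω) ∂P = Fintype.card ι := by
  rw [integral_dotProduct_self_mulVec hmeas hcov, hatMatrix_transpose, hatMatrix_idem h,
    trace_hatMatrix h]

theorem integral_sum_sq (hmeas : Measurable ε)
    (hcov : ∀ i j, ∫ ω, ε ω i * ε ω j ∂P = if i = j then 1 else 0) :
    Integrable (fun ω => (∑ i, ε ω i) ^ 2) P ∧
      ∫ ω, (∑ i, ε ω i) ^ 2 ∂P = Fintype.card κ := by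
  have h : ∀ ω, (∑ i, ε ω i) ^ 2 =
      ((Matrix.of fun (_ : Unit) (_ : κ) => (1 : ℝ)) *ᵥ ε ω) ⬝ᵥ
        ((Matrix.of fun (_ : Unit) (_ : κ) => (1 : ℝ)) *ᵥ ε ω) := fun ω => by
    simp [Matrix.mulVec, dotProduct, pow_two]
  simp only [h]
  refine ⟨integrable_dotProduct_self_mulVec hmeas hcov _, ?_⟩
  rw [integral_dotProduct_self_mulVec hmeas hcov]
  simp [Matrix.trace, Matrix.mul_apply]

end SecondMoments

section Centering

variable {n : ℕ}

/-- The centered vector `v - v̄1`. -/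
noncomputable def centered (v : Fin n → ℝ) : Fin n → ℝ :=
  v - ((∑ l, v l) / n) • (1 : Fin n → ℝ)

theorem dotProduct_self_centered (hn : 0 < n) (v : Fin n → ℝ) :
    centered v ⬝ᵥ centered v = v ⬝ᵥ v - (∑ l, v l) ^ 2 / n := by
  have hn' : (n : ℝ) ≠ 0 := by positivity
  have h1 : v ⬝ᵥ (1 : Fin n → ℝ) = ∑ l, v l := by simp [dotProduct]
  have h2 : (1 : Fin n → ℝ) ⬝ᵥ v = ∑ l, v l := by simp [dotProduct]
  have h3 : (1 : Fin n → ℝ) ⬝ᵥ (1 : Fin n → ℝ) = n := by simp [dotProduct]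
  simp only [centered, sub_dotProduct, dotProduct_sub, smul_dotProduct, dotProduct_smul, h1, h2,
    h3, smul_eq_mul]
  field_simp
  ring

theorem hatMatrix_mulVec_centered {κ : Type*} [Fintype κ] [DecidableEq κ]
    {D : Matrix (Fin n) κ ℝ} (hD : ∀ j, ∑ i, D i j = 0) (v : Fin n → ℝ) :
    hatMatrix D *ᵥ centered v = hatMatrix D *ᵥ v := by
  rw [centered, Matrix.mulVec_sub, Matrix.mulVec_smul, hatMatrix_mulVec_one hD]
  simp

theorem centered_yResp {p : ℕ} (hn : 0 < n) {X : Matrix (Fin n) (Fin p) ℝ}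
    (horth : ∀ j, ∑ i, X i j = 0) (α σ : ℝ) (β : Fin p → ℝ) (e : Fin n → ℝ) :
    centered (yResp X α β σ e) = X *ᵥ β + σ • centered e := by
  have hn' : (n : ℝ) ≠ 0 := by positivity
  have hX : ∑ i, (X *ᵥ β) i = 0 := by
    simp only [Matrix.mulVec, dotProduct]
    rw [Finset.sum_comm]
    simp [← Finset.sum_mul, horth]
  ext i
  simp only [centered, yResp, Pi.sub_apply, Pi.add_apply, Pi.smul_apply, Pi.one_apply,
    smul_eq_mul, Finset.sum_add_distrib, ← Finset.mul_sum, hX]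
  simp
  field_simp
  ring

end Centering

section Deterministic

variable {n p : ℕ} {X : Matrix (Fin n) (Fin p) ℝ} {γ : Finset (Fin p)}

theorem one_sub_residProj : 1 - residProj X γ = hatMatrix (designSub X γ) := by
  simp [residProj, hatMatrix]

theorem residProj_eq : residProj X γ = 1 - hatMatrix (designSub X γ) := rfl

theorem RsqC_eq (y : Fin n → ℝ) :
    RsqC X γ y = 1 - (((1 - hatMatrix (designSub X γ)) *ᵥ centered y) ⬝ᵥ
      ((1 - hatMatrix (designSub X γ)) *ᵥ centered y)) / (centered y ⬝ᵥ centered y) := by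
  have : (fun j => y j - (∑ l, y l) / n) = centered y := by
    ext j
    simp [centered]
  rw [RsqC, this, residProj_eq]
  simp only [dotProduct, pow_two, ← this]

/-- The residual of any submodel dominates the residual of the noise in the full model. -/
theorem residual_lower_bound (h : IsUnit (Xᵀ * X).det) (β : Fin p → ℝ) (σ : ℝ)
    (e : Fin n → ℝ) :
    σ ^ 2 * (((1 - hatMatrix X) *ᵥ e) ⬝ᵥ ((1 - hatMatrix X) *ᵥ e)) ≤
      ((1 - hatMatrix (designSub X γ)) *ᵥ (X *ᵥ β + σ • e)) ⬝ᵥ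
        ((1 - hatMatrix (designSub X γ)) *ᵥ (X *ᵥ β + σ • e)) := by
  have hX : (1 - hatMatrix X) * X = 0 := by
    rw [Matrix.sub_mul, hatMatrix_mul_self_right h, Matrix.one_mul, sub_self]
  have hD : (1 - hatMatrix X) * designSub X γ = 0 := by
    ext i j
    exact congrFun (congrFun hX i) j.1
  have hQ : (1 - hatMatrix X) * hatMatrix (designSub X γ) = 0 := by
    rw [hatMatrix.eq_def (designSub X γ), ← Matrix.mul_assoc, ← Matrix.mul_assoc, hD]
    simp
  have hres : (1 - hatMatrix X) *ᵥ ((1 - hatMatrix (designSub X γ)) *ᵥ (X *ᵥ β + σ • e)) =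
      σ • ((1 - hatMatrix X) *ᵥ e) := by
    rw [Matrix.mulVec_mulVec, Matrix.mul_sub, hQ, Matrix.mul_one, sub_zero, Matrix.mulVec_add,
      Matrix.mulVec_mulVec, hX, Matrix.mulVec_smul, Matrix.zero_mulVec, zero_add]
  have hpyth := dotProduct_self_eq_of_projection hatMatrix_transpose (hatMatrix_idem h)
    ((1 - hatMatrix (designSub X γ)) *ᵥ (X *ᵥ β + σ • e))
  rw [hres] at hpyth
  rw [hpyth]
  have := dotProduct_self_real_nonneg
    (hatMatrix X *ᵥ ((1 - hatMatrix (designSub X γ)) *ᵥ (X *ᵥ β + σ • e)))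
  simp only [smul_dotProduct, dotProduct_smul, smul_eq_mul]
  nlinarith

theorem RsqC_bounds (hn : 0 < n) (horth : ∀ j, ∑ i, X i j = 0) (h : IsUnit (Xᵀ * X).det)
    (hγ : IsUnit ((designSub X γ)ᵀ * designSub X γ).det) {α σ L B M δ c : ℝ} {β : Fin p → ℝ}
    {e : Fin n → ℝ} (hσ : 0 < σ) (hM : 0 < M)
    (hL : L * n ≤ (hatMatrix (designSub X γ) *ᵥ (X *ᵥ β)) ⬝ᵥ
      (hatMatrix (designSub X γ) *ᵥ (X *ᵥ β)))
    (hB : (X *ᵥ β) ⬝ᵥ (X *ᵥ β) ≤ B * n)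
    (he : M⁻¹ * n ≤ e ⬝ᵥ e) (he' : e ⬝ᵥ e ≤ M * n)
    (hδ : (hatMatrix (designSub X γ) *ᵥ e) ⬝ᵥ (hatMatrix (designSub X γ) *ᵥ e) +
      (hatMatrix X *ᵥ e) ⬝ᵥ (hatMatrix X *ᵥ e) + (∑ i, e i) ^ 2 / n ≤ δ * n)
    (hδL : σ ^ 2 * δ ≤ L / 4) (hδM : δ ≤ M⁻¹ / 2) (hc : 0 < c)
    (hcL : 2 * B + 2 * σ ^ 2 * M < c * (L / 4))
    (hcM : 2 * B + 2 * σ ^ 2 * M < c * (σ ^ 2 * (M⁻¹ / 2))) :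
    1 / c < RsqC X γ (yResp X α β σ e) ∧ RsqC X γ (yResp X α β σ e) < 1 - 1 / c := by
  have hn' : (0 : ℝ) < n := by exact_mod_cast hn
  have hM' : 0 < M⁻¹ := inv_pos.2 hM
  have horthγ : ∀ j, ∑ i, designSub X γ i j = 0 := fun j => horth j.1
  rw [RsqC_eq, centered_yResp hn horth]
  have hres := residual_lower_bound (γ := γ) h β σ (centered e)
  have hpyth := dotProduct_self_eq_of_projection hatMatrix_transpose (hatMatrix_idem hγ)
    (X *ᵥ β + σ • centered e)
  have hpe := dotProduct_self_eq_of_projection hatMatrix_transpose (hatMatrix_idem h)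
    (centered e)
  rw [hatMatrix_mulVec_centered horth, dotProduct_self_centered hn] at hpe
  have htot := dotProduct_self_add_le (X *ᵥ β) (σ • centered e)
  have hfit := dotProduct_self_le_add (hatMatrix (designSub X γ) *ᵥ (X *ᵥ β))
    (σ • (hatMatrix (designSub X γ) *ᵥ e))
  have hfit' : hatMatrix (designSub X γ) *ᵥ (X *ᵥ β) + σ • (hatMatrix (designSub X γ) *ᵥ e) =
      hatMatrix (designSub X γ) *ᵥ (X *ᵥ β + σ • centered e) := by
    rw [Matrix.mulVec_add, Matrix.mulVec_smul, hatMatrix_mulVec_centered horthγ]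
  rw [hfit'] at hfit
  simp only [smul_dotProduct, dotProduct_smul, smul_eq_mul] at htot hfit
  rw [dotProduct_self_centered hn] at htot
  have h1 := dotProduct_self_real_nonneg (hatMatrix (designSub X γ) *ᵥ e)
  have h2 := dotProduct_self_real_nonneg (hatMatrix X *ᵥ e)
  have h3 : 0 ≤ (∑ i, e i) ^ 2 / (n : ℝ) := by positivity
  generalize (∑ i, e i) ^ 2 / (n : ℝ) = s at *
  generalize (hatMatrix (designSub X γ) *ᵥ e) ⬝ᵥ (hatMatrix (designSub X γ) *ᵥ e) = a at *
  generalize (hatMatrix X *ᵥ e) ⬝ᵥ (hatMatrix X *ᵥ e) = b at *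
  generalize ((1 - hatMatrix X) *ᵥ centered e) ⬝ᵥ ((1 - hatMatrix X) *ᵥ centered e) = r at *
  generalize ((1 - hatMatrix (designSub X γ)) *ᵥ (X *ᵥ β + σ • centered e)) ⬝ᵥ
    ((1 - hatMatrix (designSub X γ)) *ᵥ (X *ᵥ β + σ • centered e)) = Q at *
  generalize (hatMatrix (designSub X γ) *ᵥ (X *ᵥ β + σ • centered e)) ⬝ᵥ
    (hatMatrix (designSub X γ) *ᵥ (X *ᵥ β + σ • centered e)) = H at *
  generalize (X *ᵥ β + σ • centered e) ⬝ᵥ (X *ᵥ β + σ • centered e) = m at *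
  have hσ2 : 0 < σ ^ 2 := by positivity
  have hmub : m ≤ (2 * B + 2 * σ ^ 2 * M) * n := by
    have : σ ^ 2 * (e ⬝ᵥ e - s) ≤ σ ^ 2 * (M * n) := by gcongr; linarith
    linarith
  have hr : M⁻¹ / 2 * n ≤ r := by
    have : δ * n ≤ M⁻¹ / 2 * n := by gcongr
    linarith
  have hQ : σ ^ 2 * (M⁻¹ / 2) * n ≤ Q := by
    have : σ ^ 2 * (M⁻¹ / 2 * n) ≤ σ ^ 2 * r := by gcongr
    linarith
  have hH : L / 4 * n ≤ H := by
    have h4 : σ ^ 2 * a ≤ σ ^ 2 * (δ * n) := by gcongr; linarith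
    have h5 : σ ^ 2 * δ * n ≤ L / 4 * n := by gcongr
    linarith
  have hQpos : 0 < Q := lt_of_lt_of_le (by positivity) hQ
  have hHnonneg : 0 ≤ H := by
    have h4 : 0 ≤ σ ^ 2 * (δ * n) := mul_nonneg hσ2.le (by linarith)
    have h5 : σ ^ 2 * δ * n ≤ L / 4 * n := by gcongr
    linarith
  have hm : 0 < m := by linarith
  have hcH : m < c * H := by
    have h4 := mul_lt_mul_of_pos_right hcL hn'
    have h5 : c * (L / 4 * n) ≤ c * H := by gcongr
    linarith
  have hcQ : m < c * Q := by
    have h4 := mul_lt_mul_of_pos_right hcM hn'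
    have h5 : c * (σ ^ 2 * (M⁻¹ / 2) * n) ≤ c * Q := by gcongr
    linarith
  have hRm : 1 - Q / m = H / m := by
    field_simp
    linarith
  have hlow : 1 / c < H / m := by
    rw [div_lt_div_iff₀ hc hm]
    linarith
  have hup : 1 / c < Q / m := by
    rw [div_lt_div_iff₀ hc hm]
    linarith
  exact ⟨hRm ▸ hlow, by linarith⟩

end Deterministic

section Limits

theorem eventually_isUnit_det_of_tendsto {κ : Type*} [Fintype κ] [DecidableEq κ]
    {G : ℕ → Matrix κ κ ℝ} {S : Matrix κ κ ℝ} (hS : S.PosDef)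
    (hG : Tendsto (fun n : ℕ => ((n : ℝ)⁻¹) • G n) atTop (nhds S)) :
    ∀ᶠ n in atTop, IsUnit (G n).det := by
  have hdet : Tendsto (fun n : ℕ => (((n : ℝ)⁻¹) • G n).det) atTop (nhds S.det) :=
    (continuous_id.matrix_det.tendsto S).comp hG
  filter_upwards [hdet.eventually_ne hS.det_pos.ne'] with n hn
  rw [Matrix.det_smul] at hn
  exact isUnit_iff_ne_zero.2 (right_ne_zero_of_mul hn)

theorem designSub_gram {n p : ℕ} (X : Matrix (Fin n) (Fin p) ℝ) (γ : Finset (Fin p)) :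
    (designSub X γ)ᵀ * designSub X γ = (Xᵀ * X).submatrix Subtype.val Subtype.val := by
  ext i j
  simp [designSub, Matrix.mul_apply]

theorem eventually_dotProduct_self_mulVec_le {p : ℕ} {X : (n : ℕ) → Matrix (Fin n) (Fin p) ℝ}
    {S : Matrix (Fin p) (Fin p) ℝ}
    (hX : Tendsto (fun n : ℕ => ((n : ℝ)⁻¹) • ((X n)ᵀ * X n)) atTop (nhds S))
    (β : Fin p → ℝ) :
    ∃ B : ℝ, 0 < B ∧ ∀ᶠ n : ℕ in atTop, (X n *ᵥ β) ⬝ᵥ (X n *ᵥ β) ≤ B * n := by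
  have hcont : Continuous fun G : Matrix (Fin p) (Fin p) ℝ => β ⬝ᵥ (G *ᵥ β) := by fun_prop
  have hlim := (hcont.tendsto S).comp hX
  refine ⟨|β ⬝ᵥ (S *ᵥ β)| + 1, by positivity, ?_⟩
  filter_upwards [hlim.eventually_le_const (u := |β ⬝ᵥ (S *ᵥ β)| + 1)
    (by linarith [le_abs_self (β ⬝ᵥ (S *ᵥ β))]), eventually_gt_atTop 0] with n hn hn0
  have hn' : (0 : ℝ) < n := by exact_mod_cast hn0
  have heq : β ⬝ᵥ (((X n)ᵀ * X n) *ᵥ β) = (X n *ᵥ β) ⬝ᵥ (X n *ᵥ β) := by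
    rw [← Matrix.mulVec_mulVec, Matrix.dotProduct_mulVec, Matrix.vecMul_transpose]
  simp only [Function.comp_apply, Matrix.smul_mulVec, dotProduct_smul, smul_eq_mul, heq] at hn
  rwa [inv_mul_le_iff₀ hn', mul_comm] at hn

end Limits

/-- **Lemma 3, part 1.** Under the consistency setup, for any nonempty
submodel `γ`, provided `liminf n⁻¹‖(I-Q_γ)X_Tβ_T‖² > 0`, the coefficient of
determination `R_γ²` is bounded away from `0` and `1` in probability, uniformly in
large `n`. -/
theorem Rsq_bounded_in_probability
    (p : ℕ) (hp : 1 ≤ p)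
    (Ω : Type) [MeasurableSpace Ω] (P : Measure Ω) [IsProbabilityMeasure P]
    (X : (n : ℕ) → Matrix (Fin n) (Fin p) ℝ)
    (ε : (n : ℕ) → Ω → Fin n → ℝ)
    (horth : ∀ n j, ∑ i, X n i j = 0)
    (hA2 : ∃ S₀ : Matrix (Fin p) (Fin p) ℝ, S₀.PosDef ∧
      Tendsto (fun n : ℕ => ((n : ℝ)⁻¹) • ((X n)ᵀ * X n)) atTop (nhds S₀))
    (hmeas : ∀ n, Measurable (ε n))
    (hsph : ∀ (n : ℕ) (O : Matrix (Fin n) (Fin n) ℝ), Oᵀ * O = 1 →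
      P.map (fun ω => O.mulVec (ε n ω)) = P.map (ε n))
    (hmean : ∀ n i, ∫ ω, ε n ω i ∂P = 0)
    (hcov : ∀ n i j, ∫ ω, ε n ω i * ε n ω j ∂P = if i = j then 1 else 0)
    (hA1 : ∀ c : ℝ, 0 < c → ∃ M : ℝ, 1 < M ∧ ∀ n : ℕ, 0 < n →
      ENNReal.ofReal (1 - c) <
        P {ω | M⁻¹ < (∑ i, ε n ω i ^ 2) / n ∧ (∑ i, ε n ω i ^ 2) / n < M})
    (T : Finset (Fin p)) (hT : T.Nonempty) (αT σT : ℝ) (hσ : 0 < σT)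
    (βT : Fin p → ℝ) (hβT : ∀ j ∈ T, βT j ≠ 0) (hβT' : ∀ j ∉ T, βT j = 0)
    (γ : Finset (Fin p)) (hγ : γ.Nonempty)
    (hliminf : 0 < Filter.liminf (fun n : ℕ =>
      (∑ i, ((1 - residProj (X n) γ).mulVec ((X n).mulVec βT) i) ^ 2) / n) atTop) :
    ∀ k : ℝ, 0 < k → k < 1 → ∃ c : ℝ, 2 < c ∧ ∃ N : ℕ, ∀ n, N ≤ n →
      ENNReal.ofReal (1 - k) <
        P {ω | 1 / c < RsqC (X n) γ (yResp (X n) αT βT σT (ε n ω)) ∧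
               RsqC (X n) γ (yResp (X n) αT βT σT (ε n ω)) < 1 - 1 / c} := by
  intro k hk0 hk1
  obtain ⟨S, hS, hlim⟩ := hA2
  obtain ⟨M, hM1, hM⟩ := hA1 (k / 2) (by linarith)
  obtain ⟨B, hB0, hB⟩ := eventually_dotProduct_self_mulVec_le hlim βT
  obtain ⟨L, hL0, hLlim⟩ := exists_between hliminf
  have hL := eventually_lt_of_lt_liminf hLlim
    (isBoundedUnder_of ⟨0, fun n => by positivity⟩)
  have hdet := eventually_isUnit_det_of_tendsto hS hlim
  have hdetγ : ∀ᶠ n in atTop, IsUnit ((designSub (X n) γ)ᵀ * designSub (X n) γ).det := by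
    refine eventually_isUnit_det_of_tendsto (hS.submatrix (Subtype.val_injective (p := (· ∈ γ)))) ?_
    simp only [designSub_gram]
    exact ((continuous_id.matrix_submatrix Subtype.val Subtype.val).tendsto S).comp hlim
  have hM0 : 0 < M := by linarith
  have hMi : 0 < M⁻¹ := inv_pos.2 hM0
  have hσ2 : 0 < σT ^ 2 := by positivity
  obtain ⟨δ, hδ0, hδL, hδM⟩ : ∃ δ : ℝ, 0 < δ ∧ σT ^ 2 * δ ≤ L / 4 ∧ δ ≤ M⁻¹ / 2 := by
    refine ⟨min (L / 4 / σT ^ 2) (M⁻¹ / 2), by positivity, ?_, min_le_right _ _⟩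
    rw [← le_div_iff₀' hσ2]
    exact min_le_left _ _
  obtain ⟨c, hc2, hcL, hcM⟩ : ∃ c : ℝ, 2 < c ∧ 2 * B + 2 * σT ^ 2 * M < c * (L / 4) ∧
      2 * B + 2 * σT ^ 2 * M < c * (σT ^ 2 * (M⁻¹ / 2)) := by
    have h1 : Tendsto (fun c : ℝ => c * (L / 4)) atTop atTop :=
      tendsto_id.atTop_mul_const (by positivity)
    have h2 : Tendsto (fun c : ℝ => c * (σT ^ 2 * (M⁻¹ / 2))) atTop atTop :=
      tendsto_id.atTop_mul_const (by positivity)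
    exact ((eventually_gt_atTop 2).and
      ((h1.eventually_gt_atTop _).and (h2.eventually_gt_atTop _))).exists
  refine ⟨c, hc2, ?_⟩
  have hlarge : ∀ᶠ n : ℕ in atTop, (γ.card + p + 1 : ℝ) ≤ k / 2 * δ * n :=
    (tendsto_natCast_atTop_atTop.const_mul_atTop (by positivity)).eventually_ge_atTop _
  rw [← eventually_atTop]
  filter_upwards [hB, hL, hdet, hdetγ, hlarge, eventually_gt_atTop 0]
    with n hBn hLn hdn hdγn hlargen hn0
  have hn' : (0 : ℝ) < n := by exact_mod_cast hn0
  set Z : Ω → ℝ := fun ω =>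
    (hatMatrix (designSub (X n) γ) *ᵥ ε n ω) ⬝ᵥ (hatMatrix (designSub (X n) γ) *ᵥ ε n ω) +
      (hatMatrix (X n) *ᵥ ε n ω) ⬝ᵥ (hatMatrix (X n) *ᵥ ε n ω) +
        (∑ i, ε n ω i) ^ 2 / n
  have hi1 := integrable_dotProduct_self_mulVec (hmeas n) (hcov n) (hatMatrix (designSub (X n) γ))
  have hi2 := integrable_dotProduct_self_mulVec (hmeas n) (hcov n) (hatMatrix (X n))
  obtain ⟨hi3, he3⟩ := integral_sum_sq (hmeas n) (hcov n)
  have hZint : Integrable Z P := (hi1.add hi2).add (hi3.div_const _)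
  have hZval : ∫ ω, Z ω ∂P = γ.card + p + 1 := by
    have hadd := integral_add (hi1.add hi2) (hi3.div_const (n : ℝ))
    simp only [Pi.add_apply] at hadd
    rw [hadd, integral_add hi1 hi2, integral_div, he3, integral_dotProduct_self_hatMatrix (hmeas n) (hcov n) hdn,
      integral_dotProduct_self_hatMatrix (hmeas n) (hcov n) hdγn]
    simp [hn'.ne']
  have hZnonneg : ∀ ω, 0 ≤ Z ω := fun ω =>
    add_nonneg (add_nonneg (dotProduct_self_real_nonneg _) (dotProduct_self_real_nonneg _))
      (by positivity)
  have hmarkov := mul_meas_ge_le_integral_of_nonneg (ae_of_all P hZnonneg) hZint (δ * n)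
  have hbad : P {ω | δ * n ≤ Z ω} ≤ ENNReal.ofReal (k / 2) := by
    rw [← ofReal_measureReal]
    refine ENNReal.ofReal_le_ofReal (le_of_mul_le_mul_left ?_ (mul_pos hδ0 hn'))
    linarith
  by_contra! hcon
  refine (hM n hn0).not_ge ?_
  calc _ ≤ P ({ω | 1 / c < RsqC (X n) γ (yResp (X n) αT βT σT (ε n ω)) ∧
               RsqC (X n) γ (yResp (X n) αT βT σT (ε n ω)) < 1 - 1 / c} ∪
            {ω | δ * n ≤ Z ω}) := by
        refine measure_mono fun ω hω => ?_
        by_cases hω' : δ * n ≤ Z ω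
        · exact Or.inr hω'
        refine Or.inl ?_
        have hsq : ∑ i, ε n ω i ^ 2 = ε n ω ⬝ᵥ ε n ω := by simp [dotProduct, pow_two]
        simp only [Set.mem_ofPred_eq, hsq, lt_div_iff₀ hn', div_lt_iff₀ hn'] at hω
        refine RsqC_bounds hn0 (horth n) hdn hdγn hσ hM0 ?_ hBn hω.1.le hω.2.le (not_le.1 hω').le
          hδL hδM (by linarith) hcL hcM
        rw [lt_div_iff₀ hn', one_sub_residProj] at hLn
        simpa [dotProduct, pow_two] using hLn.le
    _ ≤ _ := measure_union_le _ _
    _ ≤ ENNReal.ofReal (1 - k) + ENNReal.ofReal (k / 2) := add_le_add hcon hbad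
    _ = ENNReal.ofReal (1 - k / 2) := by
        rw [← ENNReal.ofReal_add (by linarith) (by linarith)]
        congr 1
        ring
end
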